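/- arXiv:1201.6576 — 3 statements merged into one kernel-verified Lean document; each statement's English description precedes it below -/
import Mathlib

section
/- Let n ≥ 1 and k ≥ 1 be integers. The sum, over all partitions π in NC^k(n), of the total number of blocks of π, equals binom(n(k+1) − 1, nk). -/
open Finset

/-- A finpartition of `{0,…,n-1}` (representing `{1,…,n}`) is non-crossing if there are no
`a < b < c < d` with `a, c` in one block and `b, d` in a different block. -/
def IsNoncrossing {n : ℕ} (π : Finpartition (Finset.univ : Finset (Fin n))) : Prop :=
  ∀ a b c d : Fin n, a < b → b < c → c < d →
    ∀ B ∈ π.parts, ∀ C ∈ π.parts, a ∈ B → c ∈ B → b ∈ C → d ∈ C → B = C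

/-- Filter by an arbitrary (possibly non-decidable) predicate. -/
noncomputable def fil {α : Type*} (s : Finset α) (p : α → Prop) : Finset α :=
  letI := Classical.decPred p
  s.filter p

/-- `NC n` : the set of non-crossing partitions of `{1,…,n}`. -/
noncomputable def NC (n : ℕ) : Finset (Finpartition (Finset.univ : Finset (Fin n))) :=
  fil Finset.univ IsNoncrossing

/-- `NCdiv k n` : the set of `k`-divisible non-crossing partitions of `{1,…,kn}`
(all blocks have size divisible by `k`). -/
noncomputable def NCdiv (k n : ℕ) : Finset (Finpartition (Finset.univ : Finset (Fin (k * n)))) :=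
  fil Finset.univ (fun π => IsNoncrossing π ∧ ∀ B ∈ π.parts, k ∣ B.card)

/-- `NCeq k n` : the set of `k`-equal non-crossing partitions of `{1,…,kn}`
(all blocks have size exactly `k`). -/
noncomputable def NCeq (k n : ℕ) : Finset (Finpartition (Finset.univ : Finset (Fin (k * n)))) :=
  fil Finset.univ (fun π => IsNoncrossing π ∧ ∀ B ∈ π.parts, B.card = k)

/-- The number of blocks of `π` of size `i`. -/
def blockCount {n : ℕ} (π : Finpartition (Finset.univ : Finset (Fin n))) (i : ℕ) : ℕ :=
  (π.parts.filter (fun B => B.card = i)).card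

/-! ### The cycle lemma -/

/-- Height of the lattice path attached to the cyclic sequence `g` after `m` steps. -/
def hgt (k N : ℕ) (g : ZMod (N + 1) → ℕ) (m : ℕ) : ℤ :=
  (k : ℤ) * ∑ i ∈ Finset.range m, (g (i : ZMod (N + 1)) : ℤ) - m

/-- The path stays nonnegative before its last step. -/
def GoodSeq (k N : ℕ) (g : ZMod (N + 1) → ℕ) : Prop := ∀ j ≤ N, 0 ≤ hgt k N g j

lemma sum_range_zmod (N : ℕ) (g : ZMod (N + 1) → ℤ) :
    ∑ i ∈ Finset.range (N + 1), g (i : ZMod (N + 1)) = ∑ z, g z := by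
  refine Finset.sum_bij (fun i _ => (i : ZMod (N + 1))) (by simp) ?_ ?_ (by simp)
  · intro a ha b hb h
    simp only [Finset.mem_range] at ha hb
    have := congrArg ZMod.val h
    rwa [ZMod.val_natCast_of_lt ha, ZMod.val_natCast_of_lt hb] at this
  · intro b _
    exact ⟨b.val, by simpa using ZMod.val_lt b, by simp⟩

lemma hgt_rot (k N : ℕ) (g : ZMod (N + 1) → ℕ) (s j : ℕ) :
    hgt k N (fun z => g ((s : ZMod (N + 1)) + z)) j = hgt k N g (s + j) - hgt k N g s := by
  unfold hgt
  rw [Finset.sum_range_add]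
  push_cast
  ring

lemma hgt_period (k N n : ℕ) (hN : N = k * n) (g : ZMod (N + 1) → ℕ) (hg : ∑ z, g z = n) (s : ℕ) :
    hgt k N g (s + (N + 1)) = hgt k N g s - 1 := by
  have h := hgt_rot k N g s (N + 1)
  have h2 : hgt k N (fun z => g ((s : ZMod (N + 1)) + z)) (N + 1) = -1 := by
    unfold hgt
    rw [sum_range_zmod N (fun z => (g ((s : ZMod (N + 1)) + z) : ℤ))]
    have e : ∑ z, (g ((s : ZMod (N + 1)) + z) : ℤ) = ∑ z, (g z : ℤ) :=
      Equiv.sum_comp (Equiv.addLeft (s : ZMod (N + 1))) (fun z => (g z : ℤ))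
    have e2 : (N : ℤ) = k * n := by exact_mod_cast hN
    rw [e, ← Nat.cast_sum, hg]
    push_cast
    linarith
  linarith

lemma good_rot_exists (k N n : ℕ) (hN : N = k * n) (g : ZMod (N + 1) → ℕ) (hg : ∑ z, g z = n) :
    ∃ s : ℕ, GoodSeq k N (fun z => g ((s : ZMod (N + 1)) + z)) := by
  classical
  obtain ⟨t, ht, hmin⟩ := Finset.exists_min_image (Finset.range (N + 1)) (hgt k N g) (by simp)
  have hex : ∃ s, s ≤ N ∧ ∀ m ≤ N, hgt k N g s ≤ hgt k N g m :=
    ⟨t, by simpa [Nat.lt_succ_iff] using ht, fun m hm => hmin m (by simpa [Nat.lt_succ_iff] using hm)⟩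
  refine ⟨Nat.find hex, fun j hj => ?_⟩
  obtain ⟨h1, h2⟩ := Nat.find_spec hex
  have h3 : ∀ m, m < Nat.find hex → hgt k N g (Nat.find hex) < hgt k N g m := by
    intro m hm
    have h4 := Nat.find_min hex hm
    by_contra! h5
    exact h4 ⟨by omega, fun m' hm' => h5.trans (h2 m' hm')⟩
  set s := Nat.find hex
  rw [hgt_rot]
  by_cases hs : s + j ≤ N
  · linarith [h2 _ hs]
  · obtain ⟨m, hm⟩ : ∃ m, s + j = m + (N + 1) := ⟨s + j - (N + 1), by omega⟩
    rw [hm, hgt_period k N n hN g hg]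
    have := h3 m (by omega)
    omega

lemma good_rot_unique (k N n : ℕ) (hN : N = k * n) (g : ZMod (N + 1) → ℕ) (hg : ∑ z, g z = n)
    (h0 : GoodSeq k N g) (s : ℕ) (hs : s ≤ N)
    (h1 : GoodSeq k N (fun z => g ((s : ZMod (N + 1)) + z))) : s = 0 := by
  by_contra hne
  have h2 := h0 s hs
  have h3 := h1 (N + 1 - s) (by omega)
  rw [hgt_rot, show s + (N + 1 - s) = 0 + (N + 1) by omega, hgt_period k N n hN g hg] at h3
  have : hgt k N g 0 = 0 := by simp [hgt]
  linarith

open Classical in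
lemma cycle_count (k N n : ℕ) (hN : N = k * n) :
    ∑ g ∈ (Finset.piAntidiag (univ : Finset (ZMod (N + 1))) n).filter (GoodSeq k N),
      (univ.filter (fun i => 0 < g i)).card
    = ((Finset.piAntidiag (univ : Finset (ZMod (N + 1))) n).filter (fun g => 0 < g 0)).card := by
  rw [← Finset.card_sigma]
  refine Finset.card_bij (fun p _ => fun z => p.1 (p.2 + z)) ?_ ?_ ?_
  · rintro ⟨g, i⟩ h
    simp only [mem_sigma, mem_filter, mem_piAntidiag, mem_univ, implies_true, and_true,
      true_and] at h ⊢
    refine ⟨?_, by simpa using h.2⟩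
    rw [← h.1.1]
    exact Equiv.sum_comp (Equiv.addLeft i) g
  · rintro ⟨g, i⟩ h ⟨g', i'⟩ h' heq
    simp only [mem_sigma, mem_filter, mem_piAntidiag, mem_univ, implies_true, and_true,
      true_and] at h h' heq
    have e : g' = fun z => g ((i - i') + z) := by
      funext z
      have := congrFun heq (z - i')
      simp only [add_sub_cancel] at this
      rw [← this]
      congr 1
      ring
    have h0 : i - i' = 0 := by
      have := good_rot_unique k N n hN g h.1.1 h.1.2 (i - i').val
        (by have := ZMod.val_lt (i - i'); omega)
        (by rw [ZMod.natCast_zmod_val, ← e]; exact h'.1.2)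
      rwa [ZMod.val_eq_zero] at this
    have hi : i = i' := sub_eq_zero.mp h0
    subst hi
    have : g' = g := by rw [e]; simp
    rw [this]
  · intro g hg
    simp only [mem_filter, mem_piAntidiag, mem_univ, implies_true, and_true] at hg
    obtain ⟨s, hs⟩ := good_rot_exists k N n hN g hg.1
    refine ⟨⟨fun z => g ((s : ZMod (N + 1)) + z), -(s : ZMod (N + 1))⟩, ?_, ?_⟩
    · simp only [mem_sigma, mem_filter, mem_piAntidiag, mem_univ, implies_true, and_true,
        true_and, add_neg_cancel]
      refine ⟨⟨?_, hs⟩, hg.2⟩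
      rw [← hg.1]
      exact Equiv.sum_comp (Equiv.addLeft (s : ZMod (N + 1))) g
    · funext z
      simp

lemma card_pos_zero (N n : ℕ) (hn : 1 ≤ n) :
    ((Finset.piAntidiag (univ : Finset (ZMod (N + 1))) n).filter (fun g => 0 < g 0)).card
      = Nat.choose (N + n - 1) N := by
  have h1 : ((Finset.piAntidiag (univ : Finset (ZMod (N + 1))) n).filter
      (fun g => 0 < g 0)).card = (Finset.piAntidiag (univ : Finset (ZMod (N + 1))) (n - 1)).card := by
    symm
    refine Finset.card_bij (fun g _ => g + Pi.single 0 1) ?_ ?_ ?_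
    · intro g hg
      simp only [mem_filter, mem_piAntidiag, mem_univ, implies_true, and_true, Pi.add_apply,
        Finset.sum_add_distrib] at hg ⊢
      refine ⟨?_, by simp⟩
      rw [hg]
      simp
      omega
    · intro a _ b _ h
      exact add_right_cancel h
    · intro g hg
      simp only [mem_filter, mem_piAntidiag, mem_univ, implies_true, and_true] at hg
      have e : g - Pi.single 0 1 + Pi.single 0 1 = g := by
        funext z
        by_cases hz : z = 0
        · subst hz; simp; omega
        · simp [hz]
      refine ⟨g - Pi.single 0 1, ?_, e⟩
      simp only [mem_piAntidiag, mem_univ, implies_true, and_true]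
      have h2 : ∑ z, (g - Pi.single 0 1 + Pi.single 0 1 : ZMod (N + 1) → ℕ) z = n := by rw [e, hg.1]
      simp only [Pi.add_apply, Finset.sum_add_distrib] at h2
      simp at h2 ⊢
      omega
  rw [h1, ← Finset.map_sym_eq_piAntidiag, Finset.card_map, Finset.sym_univ, Finset.card_univ,
    Sym.card_sym_eq_multichoose, ZMod.card, Nat.multichoose_eq]
  rw [show N + 1 + (n - 1) - 1 = N + n - 1 by omega]
  rw [← Nat.choose_symm (by omega)]
  congr 1
  omega

/-! ### Encoding partitions by sequences -/

section Encoding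

variable {N : ℕ} (π : Finpartition (Finset.univ : Finset (Fin N)))

/-- The least element of the block of `x`. -/
def mn (x : Fin N) : Fin N :=
  (π.part x).min' ⟨x, π.mem_part_self.mpr (mem_univ x)⟩

lemma mn_mem (x : Fin N) : mn π x ∈ π.part x := Finset.min'_mem _ _

lemma mn_le (x : Fin N) : mn π x ≤ x :=
  Finset.min'_le _ _ (π.mem_part_self.mpr (mem_univ x))

lemma part_eq_iff (x y : Fin N) : π.part x = π.part y ↔ mn π x = mn π y := by
  constructor
  · intro h
    unfold mn
    congr 1
  · intro h
    have h1 := mn_mem π x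
    have h2 := mn_mem π y
    rw [← h] at h2
    exact π.eq_of_mem_parts (π.part_mem.mpr (mem_univ x)) (π.part_mem.mpr (mem_univ y)) h1 h2

lemma mem_part_iff (x y : Fin N) : y ∈ π.part x ↔ mn π y = mn π x := by
  rw [← part_eq_iff, π.mem_part_iff_part_eq_part (mem_univ _) (mem_univ _)]

lemma mn_mn (x : Fin N) : mn π (mn π x) = mn π x :=
  (mem_part_iff π x (mn π x)).mp (mn_mem π x)

lemma part_eq_filter (x : Fin N) : π.part x = univ.filter (fun y => mn π y = mn π x) := by
  ext y
  simp [mem_part_iff]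

lemma noncross_mn (h : IsNoncrossing π) (a b c d : Fin N) (hab : a < b) (hbc : b < c) (hcd : c < d)
    (hac : mn π a = mn π c) (hbd : mn π b = mn π d) : mn π a = mn π b := by
  rw [← part_eq_iff]
  exact h a b c d hab hbc hcd (π.part a) (π.part_mem.mpr (mem_univ _)) (π.part b)
    (π.part_mem.mpr (mem_univ _)) (by simp [mem_part_iff]) (by simp [mem_part_iff, hac])
    (by simp [mem_part_iff]) (by simp [mem_part_iff, hbd])

lemma ext_mn {π π' : Finpartition (Finset.univ : Finset (Fin N))} (h : ∀ x, mn π x = mn π' x) :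
    π = π' := by
  have hp : ∀ x, π.part x = π'.part x := by
    intro x
    simp [part_eq_filter, h]
  apply Finpartition.ext
  ext B
  constructor
  · intro hB
    obtain ⟨x, hx⟩ := π.nonempty_of_mem_parts hB
    rw [← π.part_eq_of_mem hB hx, hp]
    exact π'.part_mem.mpr (mem_univ _)
  · intro hB
    obtain ⟨x, hx⟩ := π'.nonempty_of_mem_parts hB
    rw [← π'.part_eq_of_mem hB hx, ← hp]
    exact π.part_mem.mpr (mem_univ _)

/-- The sequence attached to a partition. -/
def enc (k : ℕ) (z : ZMod (N + 1)) : ℕ :=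
  if h : z.val < N then
    (univ.filter (fun y : Fin N => mn π y = ⟨z.val, h⟩)).card / k else 0

lemma fiber_dvd {k : ℕ} (hd : ∀ B ∈ π.parts, k ∣ B.card) (i : Fin N) :
    k ∣ (univ.filter (fun y : Fin N => mn π y = i)).card := by
  by_cases h : ∃ y, mn π y = i
  · obtain ⟨y, rfl⟩ := h
    rw [← part_eq_filter]
    exact hd _ (π.part_mem.mpr (mem_univ _))
  · push Not at h
    rw [Finset.filter_false_of_mem (fun y _ => h y)]
    simp

lemma enc_cast (k i : ℕ) (hi : i < N) :
    enc π k (i : ZMod (N + 1)) = (univ.filter (fun y : Fin N => mn π y = ⟨i, hi⟩)).card / k := by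
  have hv : (i : ZMod (N + 1)).val = i := ZMod.val_natCast_of_lt (by omega)
  unfold enc
  simp only [hv, hi, dif_pos]

lemma mul_enc {k : ℕ} (hd : ∀ B ∈ π.parts, k ∣ B.card) (i : ℕ) (hi : i < N) :
    k * enc π k (i : ZMod (N + 1)) = (univ.filter (fun y : Fin N => (mn π y).val = i)).card := by
  rw [enc_cast π k i hi, Nat.mul_div_cancel' (fiber_dvd π hd _)]
  simp only [Fin.ext_iff]

lemma sum_enc {k : ℕ} (hd : ∀ B ∈ π.parts, k ∣ B.card) (m : ℕ) (hm : m ≤ N) :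
    k * ∑ i ∈ Finset.range m, enc π k (i : ZMod (N + 1))
      = (univ.filter (fun y : Fin N => (mn π y).val < m)).card := by
  rw [Finset.mul_sum, Finset.card_eq_sum_card_fiberwise (f := fun y => (mn π y).val)
    (t := Finset.range m) (by intro y; simp)]
  refine Finset.sum_congr rfl fun i hi => ?_
  rw [Finset.mem_range] at hi
  rw [mul_enc π hd i (by omega), Finset.filter_filter]
  congr 1
  ext y
  simp
  omega

lemma hgt_enc {k : ℕ} (hd : ∀ B ∈ π.parts, k ∣ B.card) (m : ℕ) (hm : m ≤ N) :
    hgt k N (enc π k) m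
      = (univ.filter (fun y : Fin N => m ≤ y.val ∧ (mn π y).val < m)).card := by
  have h1 := sum_enc π hd m hm
  have h2 : (univ.filter (fun y : Fin N => (mn π y).val < m)).card
      = (univ.filter (fun y : Fin N => m ≤ y.val ∧ (mn π y).val < m)).card
        + (univ.filter (fun y : Fin N => y.val < m)).card := by
    rw [← Finset.card_union_of_disjoint]
    · congr 1
      ext y
      have := mn_le π y
      rw [Fin.le_def] at this
      simp
      omega
    · rw [Finset.disjoint_filter]
      intro y _ h
      omega
  have h3 : (univ.filter (fun y : Fin N => y.val < m)).card = m := by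
    rw [Fin.card_filter_val_lt]
    omega
  unfold hgt
  rw [← Nat.cast_sum, ← Nat.cast_mul, h1, h2, h3]
  push_cast
  ring

lemma enc_last (k : ℕ) : enc π k (N : ZMod (N + 1)) = 0 := by
  have hv : (N : ZMod (N + 1)).val = N := ZMod.val_natCast_of_lt (by omega)
  unfold enc
  simp [hv]

lemma enc_sum {k n : ℕ} (hk : 1 ≤ k) (hN : N = k * n) (hd : ∀ B ∈ π.parts, k ∣ B.card) :
    ∑ z, enc π k z = n := by
  have h1 := sum_range_zmod N (fun z => (enc π k z : ℤ))
  rw [Finset.sum_range_succ, enc_last] at h1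
  have h2 := sum_enc π hd N le_rfl
  rw [Finset.filter_true_of_mem (fun y _ => (mn π y).isLt), Finset.card_univ, Fintype.card_fin] at h2
  have h3 : ∑ i ∈ Finset.range N, enc π k (i : ZMod (N + 1)) = n :=
    Nat.eq_of_mul_eq_mul_left hk (h2.trans hN)
  have h4 : ((∑ z, enc π k z : ℕ) : ℤ) = n := by
    rw [← h3]
    push_cast
    rw [← h1]
    simp
  exact_mod_cast h4

lemma enc_good {k : ℕ} (hd : ∀ B ∈ π.parts, k ∣ B.card) : GoodSeq k N (enc π k) := by
  intro j hj
  rw [hgt_enc π hd j hj]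
  positivity

lemma enc_le {k : ℕ} (hnc : IsNoncrossing π) (hd : ∀ B ∈ π.parts, k ∣ B.card) (x : Fin N) :
    hgt k N (enc π k) (mn π x).val ≤ hgt k N (enc π k) (x.val + 1) := by
  have hle := mn_le π x
  rw [hgt_enc π hd _ (by omega), hgt_enc π hd _ (by omega), Nat.cast_le]
  refine Finset.card_le_card fun y => ?_
  simp only [mem_filter, mem_univ, true_and]
  rintro ⟨h1, h2⟩
  rw [Fin.le_def] at hle
  refine ⟨?_, by omega⟩
  by_contra h3
  have hne : mn π y ≠ mn π x := fun h => by rw [h] at h2; omega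
  have h4 : y ≠ x := fun h => hne (by rw [h])
  have h5 : mn π x ≠ y := fun h => hne (by rw [← h, mn_mn])
  apply hne
  have := noncross_mn π hnc (mn π y) (mn π x) y x (by omega) (by omega) (by omega)
    (mn_mn π y) (mn_mn π x)
  rwa [mn_mn, mn_mn] at this

lemma enc_lt {k : ℕ} (hnc : IsNoncrossing π) (hd : ∀ B ∈ π.parts, k ∣ B.card) (x : Fin N)
    (m : ℕ) (h1 : (mn π x).val < m) (h2 : m ≤ x.val) :
    hgt k N (enc π k) (x.val + 1) < hgt k N (enc π k) m := by
  have hle := mn_le π x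
  rw [hgt_enc π hd _ (by omega), hgt_enc π hd _ (by omega), Nat.cast_lt]
  refine Finset.card_lt_card (Finset.ssubset_iff_of_subset ?_ |>.mpr ⟨x, ?_, ?_⟩)
  · intro y
    simp only [mem_filter, mem_univ, true_and]
    rintro ⟨h3, h4⟩
    refine ⟨by omega, ?_⟩
    by_contra h5
    have hne : mn π x ≠ mn π y := fun h => by rw [h] at h1; omega
    have h6 : mn π y ≠ x := fun h => hne (by rw [← h, mn_mn])
    apply hne
    have := noncross_mn π hnc (mn π x) (mn π y) x y (by omega) (by omega) (by omega)
      (mn_mn π x) (mn_mn π y)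
    rwa [mn_mn, mn_mn] at this
  · simp only [mem_filter, mem_univ, true_and]
    omega
  · simp only [mem_filter, mem_univ, true_and]
    omega

end Encoding

lemma enc_inj {N k : ℕ} {π π' : Finpartition (Finset.univ : Finset (Fin N))}
    (hnc : IsNoncrossing π) (hd : ∀ B ∈ π.parts, k ∣ B.card)
    (hnc' : IsNoncrossing π') (hd' : ∀ B ∈ π'.parts, k ∣ B.card)
    (h : enc π k = enc π' k) : π = π' := by
  apply ext_mn
  intro x
  have a1 := enc_le π hnc hd x
  have a2 := enc_le π' hnc' hd' x
  have b1 := enc_lt π hnc hd x (mn π' x).val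
  have b2 := enc_lt π' hnc' hd' x (mn π x).val
  have c1 := mn_le π x
  have c2 := mn_le π' x
  rw [← h] at a2 b2
  rw [Fin.le_def] at c1 c2
  apply Fin.ext
  rcases lt_trichotomy (mn π x).val (mn π' x).val with hlt | heq | hlt
  · linarith [b1 hlt c2]
  · exact heq
  · linarith [b2 hlt c1]

lemma card_parts_enc {N k : ℕ} (hk : 1 ≤ k) (π : Finpartition (Finset.univ : Finset (Fin N)))
    (hd : ∀ B ∈ π.parts, k ∣ B.card) :
    π.parts.card = (univ.filter (fun z => 0 < enc π k z)).card := by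
  refine Finset.card_bij
    (fun B hB => ((B.min' (π.nonempty_of_mem_parts hB)).val : ZMod (N + 1))) ?_ ?_ ?_
  · intro B hB
    simp only [mem_filter, mem_univ, true_and]
    set i := B.min' (π.nonempty_of_mem_parts hB) with hi
    have hmem : i ∈ B := Finset.min'_mem _ _
    have hpart := π.part_eq_of_mem hB hmem
    have hmn : mn π i = i := by
      unfold mn
      conv_rhs => rw [hi]
      congr 1
    have := mul_enc π hd i.val i.isLt
    have hpos : 0 < (univ.filter (fun y : Fin N => (mn π y).val = i.val)).card :=
      Finset.card_pos.mpr ⟨i, by simp [hmn]⟩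
    rw [← this] at hpos
    exact Nat.pos_of_mul_pos_left hpos
  · intro B hB C hC h
    have h' := congrArg ZMod.val h
    rw [ZMod.val_natCast_of_lt (by omega), ZMod.val_natCast_of_lt (by omega)] at h'
    have h2 := Fin.ext h'
    refine π.eq_of_mem_parts hB hC (Finset.min'_mem B (π.nonempty_of_mem_parts hB)) ?_
    rw [h2]
    exact Finset.min'_mem _ _
  · intro z hz
    simp only [mem_filter, mem_univ, true_and] at hz
    unfold enc at hz
    split_ifs at hz with h
    · have h0 : (univ.filter (fun y : Fin N => mn π y = ⟨z.val, h⟩)).card ≠ 0 := by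
        intro h0
        rw [h0] at hz
        simp at hz
      obtain ⟨y, hy⟩ := Finset.card_ne_zero.mp h0
      simp only [mem_filter, mem_univ, true_and] at hy
      refine ⟨π.part y, π.part_mem.mpr (mem_univ _), ?_⟩
      have : (mn π y).val = z.val := by rw [hy]
      unfold mn at this
      rw [this]
      simp
    · omega

/-! ### Decoding -/

section Decoding

variable {N k : ℕ} (g : ZMod (N + 1) → ℕ)

/-- The opener of `x`. -/
def opn (k : ℕ) (x : Fin N) : Fin N :=
  ⟨Nat.findGreatest (fun i => hgt k N g i ≤ hgt k N g (x.val + 1)) x.val,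
    lt_of_le_of_lt (Nat.findGreatest_le _) x.isLt⟩

lemma opn_le (x : Fin N) : (opn g k x).val ≤ x.val := Nat.findGreatest_le _

lemma opn_hgt (hg : GoodSeq k N g) (x : Fin N) :
    hgt k N g (opn g k x).val ≤ hgt k N g (x.val + 1) := by
  refine Nat.findGreatest_spec (P := fun i => hgt k N g i ≤ hgt k N g (x.val + 1))
    (Nat.zero_le _) ?_
  have : hgt k N g 0 = 0 := by simp [hgt]
  rw [this]
  exact hg _ (by omega)

lemma opn_lt (x : Fin N) (m : ℕ) (h1 : (opn g k x).val < m) (h2 : m ≤ x.val) :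
    hgt k N g (x.val + 1) < hgt k N g m := by
  have := Nat.findGreatest_is_greatest
    (P := fun i => hgt k N g i ≤ hgt k N g (x.val + 1)) h1 h2
  simpa using this

lemma opn_unique (hg : GoodSeq k N g) (x : Fin N) (i : Fin N) (h0 : i.val ≤ x.val)
    (h1 : hgt k N g i.val ≤ hgt k N g (x.val + 1))
    (h2 : ∀ m, i.val < m → m ≤ x.val → hgt k N g (x.val + 1) < hgt k N g m) :
    opn g k x = i := by
  have a1 := opn_hgt g hg x
  have a2 := opn_lt g (k := k) x i.val
  have a3 := opn_le g (k := k) x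
  apply Fin.ext
  rcases lt_trichotomy (opn g k x).val i.val with hlt | heq | hlt
  · linarith [a2 hlt h0]
  · exact heq
  · linarith [h2 _ hlt a3]

lemma opn_opn (hg : GoodSeq k N g) (x : Fin N) : opn g k (opn g k x) = opn g k x := by
  apply opn_unique g hg _ _ le_rfl
  · have a1 := opn_hgt g hg x
    have a3 := opn_le g (k := k) x
    rcases a3.eq_or_lt with h | h
    · rwa [← h] at a1
    · linarith [opn_lt g (k := k) x ((opn g k x).val + 1) (by omega) (by omega)]
  · intro m h1 h2
    omega

lemma hgt_succ (i : ℕ) : hgt k N g (i + 1) = hgt k N g i + k * g (i : ZMod (N + 1)) - 1 := by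
  unfold hgt
  rw [Finset.sum_range_succ]
  push_cast
  ring

lemma opn_fiber_le (hg : GoodSeq k N g) (i : Fin N) :
    (univ.filter (fun y : Fin N => opn g k y = i)).card ≤ k * g (i.val : ZMod (N + 1)) := by
  have h : (univ.filter (fun y : Fin N => opn g k y = i)).card
      ≤ (Finset.Ico (hgt k N g i.val) (hgt k N g i.val + k * g (i.val : ZMod (N + 1)))).card := by
    refine Finset.card_le_card_of_injOn (fun y => hgt k N g (y.val + 1)) ?_ ?_
    · intro y hy
      simp only [coe_filter, mem_univ, true_and, Set.mem_ofPred_eq] at hy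
      subst hy
      simp only [coe_Ico, Set.mem_Ico]
      refine ⟨opn_hgt g hg y, ?_⟩
      have a1 := hgt_succ (k := k) g (opn g k y).val
      rcases (opn_le g (k := k) y).eq_or_lt with h | h
      · rw [h] at a1 ⊢
        linarith
      · have := opn_lt g (k := k) y ((opn g k y).val + 1) (by omega) (by omega)
        linarith
    · intro y hy y' hy' heq
      simp only [coe_filter, mem_univ, true_and, Set.mem_ofPred_eq] at hy hy' heq
      have b1 := opn_lt g (k := k) y (y'.val + 1)
      have b2 := opn_lt g (k := k) y' (y.val + 1)
      have c1 := opn_le g (k := k) y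
      have c2 := opn_le g (k := k) y'
      rw [hy] at b1 c1
      rw [hy'] at b2 c2
      apply Fin.ext
      rcases lt_trichotomy y.val y'.val with hlt | h | hlt
      · linarith [b2 (by omega) (by omega)]
      · exact h
      · linarith [b1 (by omega) (by omega)]
  rw [Int.card_Ico] at h
  refine h.trans (le_of_eq ?_)
  rw [add_sub_cancel_left, ← Nat.cast_mul, Int.toNat_natCast]

lemma good_last {n : ℕ} (hk : 1 ≤ k) (hN : N = k * n) (hg : GoodSeq k N g)
    (hs : ∑ z, g z = n) :
    ∑ i ∈ Finset.range N, g (i : ZMod (N + 1)) = n ∧ g (N : ZMod (N + 1)) = 0 := by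
  have h1 := sum_range_zmod N (fun z => (g z : ℤ))
  rw [Finset.sum_range_succ, ← Nat.cast_sum, ← Nat.cast_sum, hs] at h1
  have h2 := hg N le_rfl
  unfold hgt at h2
  rw [← Nat.cast_sum] at h2
  norm_cast at h1 
  have h3 : k * n ≤ k * ∑ i ∈ Finset.range N, g (i : ZMod (N + 1)) := by
    rw [← hN]
    zify
    push_cast at h2
    linarith
  have h4 := Nat.le_of_mul_le_mul_left h3 hk
  omega

lemma opn_fiber {n : ℕ} (hk : 1 ≤ k) (hN : N = k * n) (hg : GoodSeq k N g)
    (hs : ∑ z, g z = n) (i : Fin N) :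
    (univ.filter (fun y : Fin N => opn g k y = i)).card = k * g (i.val : ZMod (N + 1)) := by
  have h1 : ∑ i : Fin N, (univ.filter (fun y : Fin N => opn g k y = i)).card
      = ∑ i : Fin N, k * g (i.val : ZMod (N + 1)) := by
    rw [← Finset.card_eq_sum_card_fiberwise (f := opn g k) (s := univ) (t := univ)
      (by intro y; simp), ← Finset.mul_sum,
      Fin.sum_univ_eq_sum_range (fun i => g (i : ZMod (N + 1))) N,
      (good_last g hk hN hg hs).1, Finset.card_univ, Fintype.card_fin]
    exact hN
  exact (Finset.sum_eq_sum_iff_of_le (fun i _ => opn_fiber_le g hg i)).mp h1 i (mem_univ i)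

instance decKer (k : ℕ) : DecidableRel (Setoid.ker (opn g k)) :=
  fun a b => decidable_of_iff (opn g k a = opn g k b) Iff.rfl

/-- The partition attached to a sequence. -/
def dec (k : ℕ) : Finpartition (Finset.univ : Finset (Fin N)) :=
  Finpartition.ofSetoid (Setoid.ker (opn g k))

lemma mem_part_dec (x y : Fin N) : y ∈ (dec g k).part x ↔ opn g k x = opn g k y := by
  unfold dec
  rw [Finpartition.mem_part_ofSetoid_iff_rel]
  rfl

lemma mn_dec (hg : GoodSeq k N g) (x : Fin N) : mn (dec g k) x = opn g k x := by
  apply le_antisymm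
  · apply Finset.min'_le
    rw [mem_part_dec, opn_opn g hg]
  · have := mn_mem (dec g k) x
    rw [mem_part_dec] at this
    rw [this]
    exact opn_le g _

lemma dec_noncross (hg : GoodSeq k N g) : IsNoncrossing (dec g k) := by
  intro a b c d hab hbc hcd B hB C hC ha hc hb hd
  have e1 := (dec g k).part_eq_of_mem hB ha
  have e2 := (dec g k).part_eq_of_mem hC hb
  rw [← e1, mem_part_dec] at hc
  rw [← e2, mem_part_dec] at hd
  rw [← e1, ← e2, part_eq_iff, mn_dec g hg, mn_dec g hg]
  have la := opn_le g (k := k) a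
  have lb := opn_le g (k := k) b
  have gc := opn_hgt g hg c
  have gd := opn_hgt g hg d
  rw [← hc] at gc
  rw [← hd] at gd
  rw [Fin.lt_def] at hab hbc hcd
  apply Fin.ext
  rcases lt_trichotomy (opn g k a).val (opn g k b).val with hlt | h | hlt
  · have h1 := opn_lt g (k := k) c (opn g k b).val (by rw [← hc]; exact hlt) (by omega)
    have h2 := opn_lt g (k := k) d (c.val + 1) (by rw [← hd]; omega) (by omega)
    linarith
  · exact h
  · have h1 := opn_lt g (k := k) b (opn g k a).val hlt (by omega)
    have h2 := opn_lt g (k := k) c (b.val + 1) (by rw [← hc]; omega) (by omega)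
    linarith

lemma dec_dvd {n : ℕ} (hk : 1 ≤ k) (hN : N = k * n) (hg : GoodSeq k N g)
    (hs : ∑ z, g z = n) : ∀ B ∈ (dec g k).parts, k ∣ B.card := by
  intro B hB
  obtain ⟨x, hx⟩ := (dec g k).nonempty_of_mem_parts hB
  rw [← (dec g k).part_eq_of_mem hB hx, part_eq_filter]
  simp only [mn_dec g hg]
  rw [opn_fiber g hk hN hg hs]
  exact dvd_mul_right _ _

lemma enc_dec {n : ℕ} (hk : 1 ≤ k) (hN : N = k * n) (hg : GoodSeq k N g)
    (hs : ∑ z, g z = n) : enc (dec g k) k = g := by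
  funext z
  unfold enc
  simp only [mn_dec g hg]
  split_ifs with h
  · rw [opn_fiber g hk hN hg hs, Nat.mul_div_cancel_left _ hk]
    simp
  · have h1 := ZMod.val_lt z
    have h2 : z.val = N := by omega
    have h3 := (good_last g hk hN hg hs).2
    rw [← ZMod.natCast_zmod_val z, h2, h3]

end Decoding

/-- The sum of the number of blocks over all the `k`-divisible non-crossing partitions
of `{1,…,kn}` is `binom(n(k+1) - 1, nk)`. -/
theorem sum_number_of_blocks_k_divisible (n k : ℕ) (hn : 1 ≤ n) (hk : 1 ≤ k) :
    ∑ π ∈ NCdiv k n, π.parts.card = Nat.choose (n * (k + 1) - 1) (n * k) := by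
  classical
  have key : ∑ π ∈ NCdiv k n, π.parts.card
      = ∑ g ∈ (Finset.piAntidiag (univ : Finset (ZMod (k * n + 1))) n).filter (GoodSeq k (k * n)),
        (univ.filter (fun i => 0 < g i)).card := by
    have hmem : ∀ π, π ∈ NCdiv k n ↔ IsNoncrossing π ∧ ∀ B ∈ π.parts, k ∣ B.card := by
      intro π
      simp [NCdiv, fil]
    refine Finset.sum_bij (fun π _ => enc π k) ?_ ?_ ?_ ?_
    · intro π hπ
      rw [hmem] at hπ
      simp only [mem_filter, mem_piAntidiag, mem_univ, implies_true, and_true]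
      exact ⟨enc_sum π hk rfl hπ.2, enc_good π hπ.2⟩
    · intro π hπ π' hπ' h
      rw [hmem] at hπ hπ'
      exact enc_inj hπ.1 hπ.2 hπ'.1 hπ'.2 h
    · intro g hg
      simp only [mem_filter, mem_piAntidiag, mem_univ, implies_true, and_true] at hg
      refine ⟨dec g k, ?_, enc_dec g hk rfl hg.2 hg.1⟩
      rw [hmem]
      exact ⟨dec_noncross g hg.2, dec_dvd g hk rfl hg.2 hg.1⟩
    · intro π hπ
      rw [hmem] at hπ
      exact card_parts_enc hk π hπ.2
  rw [key, cycle_count k (k * n) n rfl, card_pos_zero (k * n) n hn]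
  rw [show n * (k + 1) - 1 = k * n + n - 1 by rw [mul_add, mul_comm n k, mul_one], mul_comm n k]
end

section
/- Let n ≥ 1 and 1 ≤ t ≤ n be integers. The sum, over all partitions π in NC_B(n), of the number of unordered pairs {V, −V} of non-zero blocks of π with |V| = t, equals n·binom(2n − t − 1, n − 1). -/
open Finset

/-- Negation on `[±n] = {1,…,n,-1,…,-n}`, identified with `Fin (2n)` via
`i ↦ i - 1` and `-i ↦ n + i - 1` (zero-based).  It is given by adding `n` modulo `2n`. -/
def negB {n : ℕ} (x : Fin (2 * n)) : Fin (2 * n) :=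
  ⟨(x.val + n) % (2 * n), Nat.mod_lt _ (by have := x.isLt; omega)⟩

/-- `-V` for a block `V`. -/
def negBlock {n : ℕ} (V : Finset (Fin (2 * n))) : Finset (Fin (2 * n)) :=
  V.image negB

/-- `NCB n` : non-crossing partitions of type `B_n`, i.e. non-crossing partitions
of `[±n]` such that `-V` is a block whenever `V` is, with at most one block `V`
satisfying `-V = V` (the zero-block). -/
noncomputable def NCB (n : ℕ) : Finset (Finpartition (Finset.univ : Finset (Fin (2 * n)))) :=
  fil Finset.univ (fun π => IsNoncrossing π ∧ (∀ B ∈ π.parts, negBlock B ∈ π.parts) ∧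
    (π.parts.filter (fun B => negBlock B = B)).card ≤ 1)

/-- The number of unordered pairs `{V, -V}` of non-zero blocks of `π` with `|V| = t`. -/
def pairCount {n : ℕ} (π : Finpartition (Finset.univ : Finset (Fin (2 * n)))) (t : ℕ) : ℕ :=
  (π.parts.filter (fun B => negBlock B ≠ B ∧ B.card = t)).card / 2

/-- The number of unordered pairs `{V, -V}` of non-zero blocks of `π` (of any size). -/
def totalPairCount {n : ℕ} (π : Finpartition (Finset.univ : Finset (Fin (2 * n)))) : ℕ :=
  (π.parts.filter (fun B => negBlock B ≠ B)).card / 2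

/-- The cardinality of the zero-block of `π` (`0` if there is no zero-block). -/
def zeroBlockSize {n : ℕ} (π : Finpartition (Finset.univ : Finset (Fin (2 * n)))) : ℕ :=
  ∑ B ∈ π.parts.filter (fun B => negBlock B = B), B.card

/-- `NCBdiv k n` : the `k`-divisible non-crossing partitions of type `B_{kn}`. -/
noncomputable def NCBdiv (k n : ℕ) :
    Finset (Finpartition (Finset.univ : Finset (Fin (2 * (k * n))))) :=
  fil (NCB (k * n)) (fun π => ∀ B ∈ π.parts, k ∣ B.card)


structure Good (n : ℤ) (r : ℤ → ℤ → Prop) : Prop where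
  refl : ∀ x, r x x
  symm : ∀ x y, r x y → r y x
  trans : ∀ x y z, r x y → r y z → r x z
  per : ∀ x, r x (x + 2 * n)
  shift : ∀ x y, r x y → r (x + n) (y + n)
  zero : ∀ x y, r x (x + n) → r y (y + n) → r x y
  nc : ∀ a b c d, a < b → b < c → c < d → d < a + 2 * n → r a c → r b d → r a b

def IsFirst (n : ℤ) (r : ℤ → ℤ → Prop) (x : ℤ) : Prop :=
  ∀ y, x - n ≤ y → y < x → ¬ r y x

open Classical in
noncomputable def blk (n : ℤ) (r : ℤ → ℤ → Prop) (x : ℤ) : Finset ℤ :=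
  (Finset.Ico x (x + n)).filter (fun y => r x y)

open Classical in
noncomputable def fR (n : ℤ) (r : ℤ → ℤ → Prop) (x : ℤ) : ℕ :=
  if IsFirst n r x then (blk n r x).card else 0

namespace Good
variable {n : ℤ} {r : ℤ → ℤ → Prop}

lemma shift_iff (h : Good n r) (x y : ℤ) : r (x + n) (y + n) ↔ r x y := by
  refine ⟨fun H => ?_, h.shift x y⟩
  have h1 := h.shift _ _ H
  have h2 := h.per x
  have h3 := h.symm _ _ (h.per y)
  rw [show x + n + n = x + 2 * n by ring, show y + n + n = y + 2 * n by ring] at h1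
  exact h.trans _ _ _ h2 (h.trans _ _ _ h1 h3)

lemma shift_sub (h : Good n r) {x y : ℤ} (H : r x y) : r (x - n) (y - n) := by
  rw [← h.shift_iff]; simpa using H

lemma isFirst_shift (h : Good n r) (x : ℤ) : IsFirst n r (x + n) ↔ IsFirst n r x := by
  constructor
  · intro H y h1 h2 h3
    exact H (y + n) (by omega) (by omega) (h.shift _ _ h3)
  · intro H y h1 h2 h3
    refine H (y - n) (by omega) (by omega) ?_
    have := h.shift_sub h3
    simpa using this

lemma blk_shift (h : Good n r) (x : ℤ) : (blk n r (x + n)).card = (blk n r x).card := by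
  symm
  apply Finset.card_bij (fun y _ => y + n)
  · intro y hy
    simp only [blk, Finset.mem_filter, Finset.mem_Ico] at hy ⊢
    exact ⟨by omega, h.shift _ _ hy.2⟩
  · intro a _ b _ hab; simpa using hab
  · intro y hy
    simp only [blk, Finset.mem_filter, Finset.mem_Ico] at hy ⊢
    refine ⟨y - n, ⟨by omega, ?_⟩, by ring⟩
    have := h.shift_sub hy.2
    simpa using this

lemma fR_shift (h : Good n r) (x : ℤ) : fR n r (x + n) = fR n r x := by
  unfold fR
  rw [h.blk_shift]
  have := h.isFirst_shift x
  split_ifs <;> tauto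

lemma exists_first (h : Good n r) (y : ℤ) (hy : ¬ r (y - n) y) (hn : 0 < n) :
    ∃ x, x ≤ y ∧ y < x + n ∧ IsFirst n r x ∧ r x y := by
  classical
  let s := (Finset.Icc (y - n) y).filter (fun x => r x y)
  have hs : s.Nonempty := ⟨y, by simp [s, h.refl]; omega⟩
  have hm := s.min'_mem hs
  have hmin : ∀ z ∈ s, s.min' hs ≤ z := fun z hz => s.min'_le z hz
  generalize s.min' hs = x at hm hmin
  simp only [s, Finset.mem_filter, Finset.mem_Icc] at hm hmin
  obtain ⟨⟨h1, h2⟩, h3⟩ := hm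
  have hne : x ≠ y - n := by rintro rfl; exact hy h3
  refine ⟨x, h2, by omega, ?_, h3⟩
  intro z hz1 hz2 hz3
  have hzy := h.trans _ _ _ hz3 h3
  have hz4 : z < y - n := by
    by_contra hc
    have := hmin z ⟨by omega, hzy⟩
    omega
  have hz5 : z ≠ x - n := by
    rintro rfl
    apply hy
    have := h.shift_sub h3
    exact h.trans _ _ _ (h.symm _ _ this) hzy
  -- z < y - n < x < z + n
  have h6 : r (y - n) (z + n) := by
    have e1 : r (y - n) (y + n) := by
      have := h.per (y - n)
      rwa [show y - n + 2 * n = y + n by ring] at this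
    exact h.trans _ _ _ e1 (h.shift _ _ (h.symm _ _ hzy))
  have := h.nc z (y - n) x (z + n) (by omega) (by omega) (by omega) (by omega) hz3 h6
  exact hy (h.trans _ _ _ (h.symm _ _ this) hzy)

lemma first_unique (h : Good n r) {x x' w : ℤ} (hx : IsFirst n r x) (hx' : IsFirst n r x')
    (h1 : r x w) (h2 : r x' w) (h3 : x ≤ w) (h4 : w < x + n) (h5 : x' ≤ w) (h6 : w < x' + n) :
    x = x' := by
  have h7 := h.trans _ _ _ h1 (h.symm _ _ h2)
  rcases lt_trichotomy x x' with hl | hl | hl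
  · exact (hx' x (by omega) hl h7).elim
  · exact hl
  · exact (hx x' (by omega) hl (h.symm _ _ h7)).elim

lemma first_notzero (_h : Good n r) (hn : 0 < n) {x : ℤ} (hx : IsFirst n r x) : ¬ r (x - n) x :=
  hx _ le_rfl (by omega)

lemma zero_of (h : Good n r) {x : ℤ} (H : r (x - n) x) : r x (x + n) := by
  have := h.shift _ _ H
  simpa using this

/-- covering inequality -/
lemma sum_ge (h : Good n r) (hn : 0 < n) {x y : ℤ} (hx : IsFirst n r x) (hxy : r x y)
    (h1 : x ≤ y) (h2 : y < x + n) : y + 1 - x ≤ ∑ z ∈ Finset.Ico x (y + 1), (fR n r z : ℤ) := by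
  classical
  have key : ∀ w ∈ Finset.Ico x (y + 1), ∃ z, z ∈ Finset.Ico x (y + 1) ∧ IsFirst n r z ∧ w ∈ blk n r z := by
    intro w hw
    rw [Finset.mem_Ico] at hw
    by_cases hV : r x w
    · refine ⟨x, by simp; omega, hx, ?_⟩
      simp [blk, hV]; omega
    have hwx : x ≠ w := by rintro rfl; exact hV (h.refl _)
    have hwy : w ≠ y := by rintro rfl; exact hV hxy
    have hnz : ¬ r (w - n) w := by
      intro H
      have H := h.zero_of H
      exact hV (h.nc x w y (w + n) (by omega) (by omega) (by omega) (by omega) hxy H)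
    obtain ⟨z, hz1, hz2, hz3, hz4⟩ := h.exists_first w hnz hn
    refine ⟨z, ?_, hz3, ?_⟩
    · rw [Finset.mem_Ico]
      refine ⟨?_, by omega⟩
      by_contra hc
      have := h.nc z x w y (by omega) (by omega) (by omega) (by omega) hz4 hxy
      exact hx z (by omega) (by omega) this
    · simp [blk, hz4]; omega
  have hsub : Finset.Ico x (y + 1) ⊆ (Finset.Ico x (y + 1)).biUnion
      (fun z => if IsFirst n r z then blk n r z else ∅) := by
    intro w hw
    obtain ⟨z, hz1, hz2, hz3⟩ := key w hw
    rw [Finset.mem_biUnion]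
    exact ⟨z, hz1, by simp [hz2, hz3]⟩
  have h3 := (Finset.card_le_card hsub).trans Finset.card_biUnion_le
  rw [Int.card_Ico] at h3
  have h4 : ∀ z, (if IsFirst n r z then blk n r z else ∅).card = fR n r z := by
    intro z; unfold fR; split_ifs <;> simp
  simp only [h4] at h3
  zify at h3
  omega

lemma sum_le (h : Good n r) (hn : 0 < n) {x x0 y : ℤ} (hxy : r x0 y)
    (h0 : y - n ≤ x0) (h1 : x0 < x) (h2 : x ≤ y) :
    ∑ z ∈ Finset.Ico x (y + 1), (fR n r z : ℤ) ≤ y - x := by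
  classical
  have h4 : ∀ z, fR n r z = (if IsFirst n r z then blk n r z else ∅).card := by
    intro z; unfold fR; split_ifs <;> simp
  have hb : ((Finset.Ico x (y + 1)).biUnion
      (fun z => if IsFirst n r z then blk n r z else ∅)).card = ∑ z ∈ Finset.Ico x (y + 1), fR n r z := by
    rw [Finset.card_biUnion]
    · simp only [h4]
    · intro z hz z' hz' hne
      rw [Function.onFun, Finset.disjoint_left]
      intro w hw hw'
      split_ifs at hw hw' <;> simp only [blk, Finset.mem_filter, Finset.mem_Ico, Finset.notMem_empty] at hw hw'
      rename_i a b
      exact hne (h.first_unique a b hw.2 hw'.2 hw.1.1 hw.1.2 hw'.1.1 hw'.1.2)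
  have hsub : (Finset.Ico x (y + 1)).biUnion
      (fun z => if IsFirst n r z then blk n r z else ∅) ⊆ Finset.Ico x y := by
    intro w hw
    rw [Finset.mem_biUnion] at hw
    obtain ⟨z, hz, hw⟩ := hw
    rw [Finset.mem_Ico] at hz
    split_ifs at hw with hF
    · simp only [blk, Finset.mem_filter, Finset.mem_Ico] at hw
      rw [Finset.mem_Ico]
      refine ⟨by omega, ?_⟩
      have hx0 := hF x0 (by omega) (by omega)
      have hzy : ¬ r z y := fun H => hx0 (h.trans _ _ _ hxy (h.symm _ _ H))
      have hne : z ≠ y := by rintro rfl; exact hzy (h.refl _)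
      have hne' : w ≠ y := by rintro rfl; exact hzy hw.2
      by_contra hc
      exact hx0 (h.nc x0 z y w (by omega) (by omega) (by omega) (by omega) hxy hw.2)
    · simp at hw
  have h5 := Finset.card_le_card hsub
  rw [hb, Int.card_Ico] at h5
  zify at h5
  omega

lemma sum_period (h : Good n r) (hn : 0 < n) :
    ∑ z ∈ Finset.Ico 0 n, (fR n r z : ℤ) ≤ n := by
  classical
  have h4 : ∀ z, fR n r z = (if IsFirst n r z then (blk n r z).image (· % n) else ∅).card := by
    intro z; unfold fR; split_ifs
    · rw [Finset.card_image_of_injOn]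
      intro a ha b hb hab
      simp only [blk, Finset.coe_filter, Finset.mem_Ico, Set.mem_ofPred_eq] at ha hb
      simp only at hab
      obtain ⟨k, hk⟩ := (Int.ModEq.dvd (hab : a % n = b % n) : n ∣ b - a)
      have : k = 0 := by
        have h1 : n * k < n * 1 := by omega
        have h2 : n * (-1) < n * k := by omega
        have h1 := lt_of_mul_lt_mul_left h1 hn.le
        have h2 := lt_of_mul_lt_mul_left h2 hn.le
        omega
      subst this
      omega
    · simp
  have hb : ((Finset.Ico 0 n).biUnion
      (fun z => if IsFirst n r z then (blk n r z).image (· % n) else ∅)).card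
        = ∑ z ∈ Finset.Ico 0 n, fR n r z := by
    rw [Finset.card_biUnion]
    · simp only [h4]
    · intro z hz z' hz' hne
      rw [Function.onFun, Finset.disjoint_left]
      intro v hw hw'
      simp only [Finset.coe_Ico, Set.mem_Ico] at hz hz'
      split_ifs at hw hw' <;> simp only [blk, Finset.mem_image, Finset.mem_filter, Finset.mem_Ico, Finset.notMem_empty] at hw hw'
      rename_i a b
      obtain ⟨w, hw, hwv⟩ := hw
      obtain ⟨w', hw', hwv'⟩ := hw'
      obtain ⟨k, hk⟩ := (Int.ModEq.dvd (hwv.trans hwv'.symm : w % n = w' % n) : n ∣ w' - w)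
      have h1 : n * k < n * 2 := by omega
      have h2 : n * (-2) < n * k := by omega
      have h1 := lt_of_mul_lt_mul_left h1 hn.le
      have h2 := lt_of_mul_lt_mul_left h2 hn.le
      have h3 : k = 0 ∨ k = 1 ∨ k = -1 := by omega
      rcases h3 with rfl | rfl | rfl
      · have : w' = w := by omega
        subst this
        exact hne (h.first_unique a b hw.2 hw'.2 hw.1.1 hw.1.2 hw'.1.1 hw'.1.2)
      · have : w' = w + n := by omega
        subst this
        have := h.first_unique ((h.isFirst_shift z).2 a) b (h.shift _ _ hw.2) hw'.2 (by omega) (by omega) (by omega) (by omega)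
        omega
      · have : w = w' + n := by omega
        subst this
        have := h.first_unique ((h.isFirst_shift z').2 b) a (h.shift _ _ hw'.2) hw.2 (by omega) (by omega) (by omega) (by omega)
        omega
  have hsub : (Finset.Ico 0 n).biUnion
      (fun z => if IsFirst n r z then (blk n r z).image (· % n) else ∅) ⊆ Finset.Ico 0 n := by
    intro w hw
    rw [Finset.mem_biUnion] at hw
    obtain ⟨z, hz, hw⟩ := hw
    split_ifs at hw with hF
    · simp only [Finset.mem_image] at hw
      obtain ⟨a, _, rfl⟩ := hw
      rw [Finset.mem_Ico]
      exact ⟨Int.emod_nonneg _ (by omega), Int.emod_lt_of_pos _ hn⟩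
    · simp at hw
  have h5 := Finset.card_le_card hsub
  rw [hb, Int.card_Ico] at h5
  zify at h5
  omega

end Good

structure Walk (n m : ℤ) (f : ℤ → ℕ) (S : ℤ → ℤ) : Prop where
  npos : 0 < n
  mnn : 0 ≤ m
  step : ∀ x, S (x + 1) = S x + f x - 1
  per : ∀ x, S (x + n) = S x - m

def Own (S : ℤ → ℤ) (x y : ℤ) : Prop :=
  x ≤ y ∧ S x ≤ S (y + 1) ∧ ∀ z, x < z → z ≤ y → S (y + 1) < S z

def BRel (n : ℤ) (S : ℤ → ℤ) (y z : ℤ) : Prop :=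
  (∃ x k, Own S x y ∧ Own S (x + 2 * n * k) z) ∨ ((∀ x, ¬ Own S x y) ∧ ∀ x, ¬ Own S x z)

lemma Own.unique {S : ℤ → ℤ} {x x' y : ℤ} (h : Own S x y) (h' : Own S x' y) : x = x' := by
  obtain ⟨h1, h2, h3⟩ := h
  obtain ⟨h1', h2', h3'⟩ := h'
  rcases lt_trichotomy x x' with hl | hl | hl
  · have := h3 x' hl h1'; omega
  · exact hl
  · have := h3' x hl h1; omega

lemma Own.lam {S : ℤ → ℤ} {x y u v : ℤ} (h : Own S x y) (h' : Own S u v) (h1 : x < u) (h2 : u ≤ y) :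
    v < y := by
  by_contra hc
  rcases (not_lt.1 hc).eq_or_lt with rfl | hl
  · have := h.unique h'; omega
  · have e1 := h.2.2 u h1 h2
    have e2 := h'.2.2 (y + 1) (by omega) (by omega)
    have e3 := h'.2.1
    omega

lemma Own.four {S : ℤ → ℤ} {x u p q s t : ℤ} (h1 : p < q) (h2 : q < s) (h3 : s < t)
    (a1 : Own S x p) (a2 : Own S x s) (a3 : Own S u q) (a4 : Own S u t) : x = u := by
  rcases lt_trichotomy x u with hl | hl | hl
  · have := a2.lam a4 hl (by have := a3.1; omega); omega
  · exact hl
  · have := a3.lam a2 hl (by have := a1.1; omega); omega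

lemma unowned {S : ℤ → ℤ} {y : ℤ} (h : ∀ x, ¬ Own S x y) (x : ℤ) (hx : x ≤ y) : S (y + 1) < S x := by
  classical
  by_contra hc
  let s := (Finset.Icc x y).filter (fun z => S z ≤ S (y + 1))
  have hs : s.Nonempty := ⟨x, by simp [s]; omega⟩
  have hm := s.max'_mem hs
  have hmax : ∀ z ∈ s, z ≤ s.max' hs := fun z hz => s.le_max' z hz
  generalize s.max' hs = w at hm hmax
  simp only [s, Finset.mem_filter, Finset.mem_Icc] at hm hmax
  refine h w ⟨hm.1.2, hm.2, fun z h1 h2 => ?_⟩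
  by_contra hc'
  have := hmax z ⟨by omega, by omega⟩
  omega

lemma mulcases (n k : ℤ) (hn : 0 < n) : k = 0 ∨ k = 1 ∨ 4 * n ≤ 2 * n * k ∨ 2 * n * k ≤ - 2 * n := by
  rcases lt_trichotomy k 0 with h | h | h
  · right; right; right; nlinarith
  · exact Or.inl h
  · by_cases h1 : k = 1
    · exact Or.inr (Or.inl h1)
    · right; right; left
      have : 2 ≤ k := by omega
      nlinarith

namespace Walk
variable {n m : ℤ} {f : ℤ → ℕ} {S : ℤ → ℤ}

lemma own_lt (h : Walk n m f S) {x y : ℤ} (H : Own S x y) : y < x + n := by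
  by_contra hc
  have h1 := H.2.2 (x + n) (by have := h.npos; omega) (by omega)
  have := h.per x
  have := h.mnn
  have := H.2.1
  omega

lemma own_add (h : Walk n m f S) {x y : ℤ} (H : Own S x y) : Own S (x + n) (y + n) := by
  obtain ⟨h1, h2, h3⟩ := H
  have hp := h.per
  refine ⟨by omega, ?_, ?_⟩
  · rw [show y + n + 1 = (y + 1) + n by ring, hp, hp]; omega
  · intro z hz1 hz2
    have := h3 (z - n) (by omega) (by omega)
    have e := hp (z - n)
    rw [sub_add_cancel] at e
    rw [show y + n + 1 = (y + 1) + n by ring, hp]; omega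

lemma own_sub (h : Walk n m f S) {x y : ℤ} (H : Own S x y) : Own S (x - n) (y - n) := by
  obtain ⟨h1, h2, h3⟩ := H
  have hp : ∀ z, S (z - n) = S z + m := by
    intro z; have := h.per (z - n); rw [sub_add_cancel] at this; omega
  refine ⟨by omega, ?_, ?_⟩
  · rw [show y - n + 1 = (y + 1) - n by ring, hp, hp]; omega
  · intro z hz1 hz2
    have := h3 (z + n) (by omega) (by omega)
    have e := h.per z
    rw [show y - n + 1 = (y + 1) - n by ring, hp]; omega

lemma own_sub2 (h : Walk n m f S) {x y : ℤ} (H : Own S x y) : Own S (x - 2 * n) (y - 2 * n) := by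
  have := h.own_sub (h.own_sub H)
  rwa [show x - n - n = x - 2 * n by ring, show y - n - n = y - 2 * n by ring] at this

lemma own_add2 (h : Walk n m f S) {x y : ℤ} (H : Own S x y) : Own S (x + 2 * n) (y + 2 * n) := by
  have := h.own_add (h.own_add H)
  rwa [show x + n + n = x + 2 * n by ring, show y + n + n = y + 2 * n by ring] at this

lemma un_add (h : Walk n m f S) {y : ℤ} (H : ∀ x, ¬ Own S x y) : ∀ x, ¬ Own S x (y + n) := by
  intro x hx
  have := h.own_sub hx
  rw [add_sub_cancel_right] at this
  exact H _ this

lemma un_sub (h : Walk n m f S) {y : ℤ} (H : ∀ x, ¬ Own S x y) : ∀ x, ¬ Own S x (y - n) := by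
  intro x hx
  have := h.own_add hx
  rw [sub_add_cancel] at this
  exact H _ this

lemma rel_nc_un (h : Walk n m f S) {a b c d x k : ℤ} (h1 : a < b) (h2 : b < c) (h3 : c < d)
    (h4 : d < a + 2 * n) (ha : ∀ x, ¬ Own S x a) (hc : ∀ x, ¬ Own S x c)
    (hb : Own S x b) (hd : Own S (x + 2 * n * k) d) : False := by
  have key : ∀ a b x, a < b → (∀ x, ¬ Own S x a) → Own S x b → a < x := by
    intro a b x hab ha hb
    by_contra hc
    have e1 := unowned ha x (by omega)
    have e2 := hb.2.2 (a + 1) (by omega) (by omega)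
    have e3 := hb.2.1
    omega
  have k1 := key a b x h1 ha hb
  have k2 := key c d _ h3 hc hd
  have k3 := hb.1
  have k4 := hd.1
  have := h.npos
  rcases mulcases n k h.npos with rfl | rfl | h5 | h5 <;> omega

theorem good (h : Walk n m f S) : Good n (BRel n S) where
  refl x := by
    by_cases H : ∃ u, Own S u x
    · obtain ⟨u, hu⟩ := H
      exact Or.inl ⟨u, 0, hu, by simpa using hu⟩
    · push Not at H
      exact Or.inr ⟨H, H⟩
  symm x y H := by
    rcases H with ⟨u, k, h1, h2⟩ | ⟨h1, h2⟩
    · refine Or.inl ⟨_, -k, h2, ?_⟩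
      rwa [show u + 2 * n * k + 2 * n * -k = u by ring]
    · exact Or.inr ⟨h2, h1⟩
  trans x y z H H' := by
    rcases H with ⟨u, k, h1, h2⟩ | ⟨h1, h2⟩
    · rcases H' with ⟨u', k', h1', h2'⟩ | ⟨h1', h2'⟩
      · have e := h2.unique h1'
        refine Or.inl ⟨u, k + k', h1, ?_⟩
        rw [← e] at h2'
        rwa [show u + 2 * n * (k + k') = u + 2 * n * k + 2 * n * k' by ring]
      · exact (h1' _ h2).elim
    · rcases H' with ⟨u', k', h1', h2'⟩ | ⟨h1', h2'⟩
      · exact (h2 _ h1').elim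
      · exact Or.inr ⟨h1, h2'⟩
  per x := by
    by_cases H : ∃ u, Own S u x
    · obtain ⟨u, hu⟩ := H
      refine Or.inl ⟨u, 1, hu, ?_⟩
      simpa using h.own_add2 hu
    · push Not at H
      refine Or.inr ⟨H, ?_⟩
      have := h.un_add (h.un_add H)
      rwa [show x + n + n = x + 2 * n by ring] at this
  shift x y H := by
    rcases H with ⟨u, k, h1, h2⟩ | ⟨h1, h2⟩
    · refine Or.inl ⟨u + n, k, h.own_add h1, ?_⟩
      rw [show u + n + 2 * n * k = u + 2 * n * k + n by ring]
      exact h.own_add h2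
    · exact Or.inr ⟨h.un_add h1, h.un_add h2⟩
  zero x y H H' := by
    have key : ∀ x, BRel n S x (x + n) → ∀ u, ¬ Own S u x := by
      intro x H u hu
      rcases H with ⟨v, k, h1, h2⟩ | ⟨h1, h2⟩
      · have e1 := hu.unique h1
        have e2 := (h.own_add h1).unique h2
        have := h.npos
        rcases mulcases n k h.npos with rfl | rfl | h5 | h5 <;> omega
      · exact h1 u hu
    exact Or.inr ⟨key x H, key y H'⟩
  nc a b c d h1 h2 h3 h4 hac hbd := by
    have hn := h.npos
    rcases hac with ⟨x, k, hx1, hx2⟩ | ⟨ha, hc⟩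
    · rcases hbd with ⟨u, l, hu1, hu2⟩ | ⟨hb, hd⟩
      · have b1 := hx1.1
        have b2 := hx2.1
        have b3 := hu1.1
        have b4 := hu2.1
        have c1 := h.own_lt hx1
        have c2 := h.own_lt hx2
        have c3 := h.own_lt hu1
        have c4 := h.own_lt hu2
        rcases mulcases n k hn with rfl | rfl | h5 | h5
        · simp only [mul_zero, add_zero] at hx2
          rcases mulcases n l hn with rfl | rfl | h6 | h6
          · simp only [mul_zero, add_zero] at hu2
            have := Own.four h1 h2 h3 hx1 hx2 hu1 hu2
            subst this
            exact Or.inl ⟨x, 0, hx1, by simpa using hu1⟩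
          · have hd := h.own_sub2 hu2
            simp only [mul_one, add_sub_cancel_right] at hd
            have := Own.four (by omega) h1 h2 hd hu1 hx1 hx2
            subst this
            exact Or.inl ⟨u, 0, hx1, by simpa using hu1⟩
          · omega
          · omega
        · have hc := h.own_sub2 hx2
          simp only [mul_one, add_sub_cancel_right] at hc
          rcases mulcases n l hn with rfl | rfl | h6 | h6
          · simp only [mul_zero, add_zero] at hu2
            have := Own.four (by omega) (by omega) (by omega) (h.own_sub2 hu1) (h.own_sub2 hu2) hc hx1
            refine Or.inl ⟨x, 1, hx1, ?_⟩
            rw [← this]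
            simpa using hu1
          · have hd := h.own_sub2 hu2
            simp only [mul_one, add_sub_cancel_right] at hd
            have := Own.four (by omega) (by omega) h1 hc hx1 hd hu1
            subst this
            exact Or.inl ⟨x, 0, hx1, by simpa using hu1⟩
          · omega
          · omega
        · omega
        · omega
      · have hd' := h.un_sub (h.un_sub hd)
        rw [show d - n - n = d - 2 * n by ring] at hd'
        exact (h.rel_nc_un (by omega) h1 h2 (by omega) hd' hb hx1 hx2).elim
    · rcases hbd with ⟨u, l, hu1, hu2⟩ | ⟨hb, hd⟩
      · exact (h.rel_nc_un h1 h2 h3 h4 ha hc hu1 hu2).elim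
      · exact Or.inr ⟨ha, hb⟩

lemma own_self (h : Walk n m f S) {x : ℤ} : Own S x x ↔ 0 < f x := by
  have := h.step x
  constructor
  · intro H; have := H.2.1; omega
  · intro H; exact ⟨le_rfl, by omega, fun z h1 h2 => by omega⟩

lemma own_owner {x y : ℤ} (H : Own S x y) : Own S x x := by
  rcases H.1.eq_or_lt with rfl | hl
  · exact H
  · have := H.2.2 (x + 1) (by omega) (by omega)
    have := H.2.1
    exact ⟨le_rfl, by omega, fun z h1 h2 => by omega⟩

lemma isFirst_iff (h : Walk n m f S) (x : ℤ) : IsFirst n (BRel n S) x ↔ 0 < f x := by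
  have hn := h.npos
  constructor
  · intro H
    by_contra hf
    rw [← h.own_self] at hf
    by_cases hu : ∃ u, Own S u x
    · obtain ⟨u, hu⟩ := hu
      have h1 := hu.1
      have hne : u ≠ x := by rintro rfl; exact hf hu
      have := h.own_lt hu
      exact H u (by omega) (by omega) (Or.inl ⟨u, 0, own_owner hu, by simpa using hu⟩)
    · push Not at hu
      exact H (x - n) (by omega) (by omega) (Or.inr ⟨h.un_sub hu, hu⟩)
  · intro hf y h1 h2 H
    rw [← h.own_self] at hf
    rcases h.good.symm _ _ H with ⟨u, k, e1, e2⟩ | ⟨e1, e2⟩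
    · have := hf.unique e1
      subst this
      have := e2.1
      have := h.own_lt e2
      rcases mulcases n k h.npos with rfl | rfl | h5 | h5 <;> omega
    · exact e1 _ hf

lemma blk_iff (h : Walk n m f S) {x : ℤ} (hf : 0 < f x) (y : ℤ) : y ∈ blk n (BRel n S) x ↔ Own S x y := by
  have hn := h.npos
  have hf' := hf
  rw [← h.own_self] at hf
  simp only [blk, Finset.mem_filter, Finset.mem_Ico]
  constructor
  · rintro ⟨⟨h1, h2⟩, H⟩
    rcases H with ⟨u, k, e1, e2⟩ | ⟨e1, e2⟩
    · have := hf.unique e1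
      subst this
      have := e2.1
      have := h.own_lt e2
      rcases mulcases n k h.npos with rfl | rfl | h5 | h5
      · simpa using e2
      all_goals omega
    · exact (e1 _ hf).elim
  · intro H
    exact ⟨⟨H.1, h.own_lt H⟩, Or.inl ⟨x, 0, hf, by simpa using H⟩⟩

lemma blk_card (h : Walk n m f S) {x : ℤ} (hf : 0 < f x) : (blk n (BRel n S) x).card = f x := by
  have : (Finset.Ico (S x) (S (x + 1) + 1)).card = f x := by
    have := h.step x
    rw [Int.card_Ico]; omega
  rw [← this]
  apply Finset.card_bij (fun y _ => S (y + 1))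
  · intro y hy
    rw [h.blk_iff hf] at hy
    rw [Finset.mem_Ico]
    refine ⟨hy.2.1, ?_⟩
    rcases hy.1.eq_or_lt with rfl | hl
    · omega
    · have := hy.2.2 (x + 1) (by omega) (by omega)
      omega
  · intro a ha b hb hab
    rw [h.blk_iff hf] at ha hb
    have h1 := ha.1
    have h2 := hb.1
    rcases lt_trichotomy a b with hl | hl | hl
    · have := hb.2.2 (a + 1) (by omega) (by omega); omega
    · exact hl
    · have := ha.2.2 (b + 1) (by omega) (by omega); omega
  · intro j hj
    rw [Finset.mem_Ico] at hj
    have hn := h.npos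
    have hex : ∃ d : ℕ, S (x + d + 1) ≤ j := by
      refine ⟨(n - 1).toNat, ?_⟩
      rw [show x + ((n - 1).toNat : ℤ) + 1 = x + n by omega, h.per]
      have := h.mnn; omega
    classical
    have hsp := Nat.find_spec hex
    have hmin := fun d (hd : d < Nat.find hex) => Nat.find_min hex hd
    generalize Nat.find hex = d at hsp hmin
    have heq : S (x + d + 1) = j := by
      rcases Nat.eq_zero_or_pos d with rfl | hd
      · simp only [Nat.cast_zero, add_zero] at hsp ⊢; omega
      · have e1 := hmin (d - 1) (by omega)
        rw [show x + ((d - 1 : ℕ) : ℤ) + 1 = x + d by omega] at e1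
        have := h.step (x + d)
        omega
    refine ⟨x + d, ?_, heq⟩
    rw [h.blk_iff hf]
    refine ⟨by omega, by omega, ?_⟩
    intro z h1 h2
    have e1 := hmin (z - x - 1).toNat (by omega)
    rw [show x + ((z - x - 1).toNat : ℤ) + 1 = z by omega] at e1
    omega

theorem fR_eq (h : Walk n m f S) (x : ℤ) : fR n (BRel n S) x = f x := by
  unfold fR
  rw [h.isFirst_iff]
  split_ifs with hf
  · exact h.blk_card hf
  · omega

end Walk

/-- Partial sums. -/
noncomputable def Sf (f : ℤ → ℕ) (x : ℤ) : ℤ :=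
  ∑ z ∈ Finset.Ico 0 x, ((f z : ℤ) - 1) - ∑ z ∈ Finset.Ico x 0, ((f z : ℤ) - 1)

lemma Ico_insert_left' (a b : ℤ) (h : a < b) : Finset.Ico a b = insert a (Finset.Ico (a + 1) b) := by
  ext; simp; omega

lemma Ico_insert_right' (a b : ℤ) (h : a ≤ b) : Finset.Ico a (b + 1) = insert b (Finset.Ico a b) := by
  ext; simp; omega

lemma Sf_step (f : ℤ → ℕ) (x : ℤ) : Sf f (x + 1) = Sf f x + f x - 1 := by
  unfold Sf
  rcases le_or_gt 0 x with h | h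
  · rw [Ico_insert_right' 0 x h, Finset.sum_insert (by simp), Finset.Ico_eq_empty (a := x) (by omega),
      Finset.Ico_eq_empty (a := x + 1) (by omega)]
    simp; ring
  · rw [Ico_insert_left' x 0 h, Finset.sum_insert (by simp), Finset.Ico_eq_empty (b := x) (by omega),
      Finset.Ico_eq_empty (b := x + 1) (by omega)]
    simp; ring

lemma Sf_sub (f : ℤ → ℕ) (a b : ℤ) (h : a ≤ b) :
    Sf f b - Sf f a = ∑ z ∈ Finset.Ico a b, (f z : ℤ) - (b - a) := by
  induction b, h using Int.leInduction with
  | base => simp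
  | succ b hb ih =>
    rw [Ico_insert_right' a b hb, Finset.sum_insert (by simp), Sf_step]
    omega

lemma Sf_walk (n : ℤ) (hn : 0 < n) (f : ℤ → ℕ) (hf : ∀ x, f (x + n) = f x)
    (hs : ∑ z ∈ Finset.Ico 0 n, (f z : ℤ) ≤ n) :
    Walk n (Sf f 0 - Sf f n) f (Sf f) where
  npos := hn
  mnn := by
    have := Sf_sub f 0 n hn.le
    omega
  step := Sf_step f
  per x := by
    induction x using Int.induction_on with
    | zero => simp
    | succ i ih =>
      rw [show (i : ℤ) + 1 + n = (i + n) + 1 by ring, Sf_step, Sf_step, ih, hf]; ring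
    | pred i ih =>
      have e1 := Sf_step f (-i - 1)
      have e2 := Sf_step f (-i - 1 + n)
      rw [hf] at e2
      rw [show -(i : ℤ) - 1 + n + 1 = -i + n by ring] at e2
      rw [show -(i : ℤ) - 1 + 1 = -i by ring] at e1
      omega

theorem Good.rel_eq {n : ℤ} {r : ℤ → ℤ → Prop} (h : Good n r) (hn : 0 < n) (y z : ℤ) :
    r y z ↔ BRel n (Sf (fR n r)) y z := by
  have hW := Sf_walk n hn (fR n r) h.fR_shift (h.sum_period hn)
  have own1 : ∀ x y, IsFirst n r x → r x y → x ≤ y → y < x + n → Own (Sf (fR n r)) x y := by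
    intro x y h1 h2 h3 h4
    refine ⟨h3, ?_, ?_⟩
    · have := h.sum_ge hn h1 h2 h3 h4
      have := Sf_sub (fR n r) x (y + 1) (by omega)
      omega
    · intro z hz1 hz2
      have := h.sum_le hn h2 (by omega) hz1 hz2
      have := Sf_sub (fR n r) z (y + 1) (by omega)
      omega
  have own0 : ∀ y, r (y - n) y → ∀ x, ¬ Own (Sf (fR n r)) x y := by
    intro y hy x hx
    have e1 := hW.own_lt hx
    have := h.sum_le hn hy le_rfl (by omega) hx.1
    have := Sf_sub (fR n r) x (y + 1) (by have := hx.1; omega)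
    have := hx.2.1
    omega
  have shk : ∀ k : ℤ, ∀ x, r x (x + 2 * n * k) := by
    intro k
    induction k using Int.induction_on with
    | zero => intro x; simpa using h.refl x
    | succ i ih =>
      intro x
      have := h.trans _ _ _ (ih x) (h.per _)
      rwa [show x + 2 * n * i + 2 * n = x + 2 * n * (i + 1) by ring] at this
    | pred i ih =>
      intro x
      have := h.per (x + 2 * n * (-i - 1))
      rw [show x + 2 * n * (-i - 1) + 2 * n = x + 2 * n * -i by ring] at this
      exact h.trans _ _ _ (ih x) (h.symm _ _ this)
  constructor
  · intro H
    by_cases hy : r (y - n) y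
    · have hz : r (z - n) z := by
        have := h.shift_sub H
        exact h.trans _ _ _ (h.symm _ _ this) (h.trans _ _ _ hy H)
      exact Or.inr ⟨own0 y hy, own0 z hz⟩
    · have hz : ¬ r (z - n) z := by
        intro hz
        have := h.shift_sub H
        exact hy (h.trans _ _ _ this (h.trans _ _ _ hz (h.symm _ _ H)))
      obtain ⟨x, hx1, hx2, hx3, hx4⟩ := h.exists_first y hy hn
      obtain ⟨u, hu1, hu2, hu3, hu4⟩ := h.exists_first z hz hn
      -- firsts are congruent
      have hxu : r x u := h.trans _ _ _ hx4 (h.trans _ _ _ H (h.symm _ _ hu4))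
      let k := (u - x + n) / (2 * n)
      have hk0 : 2 * n * k + (u - x + n) % (2 * n) = u - x + n := Int.mul_ediv_add_emod _ _
      have hk1 := Int.emod_nonneg (u - x + n) (b := 2 * n) (by omega)
      have hk2 := Int.emod_lt_of_pos (u - x + n) (b := 2 * n) (by omega)
      have hxk := shk k x
      have h5 : r (x + 2 * n * k) u := h.trans _ _ _ (h.symm _ _ hxk) hxu
      have h5' : r (u - 2 * n * k) x := by
        have := shk k (u - 2 * n * k)
        rw [sub_add_cancel] at this
        exact h.trans _ _ _ this (h.symm _ _ hxu)
      have h6 : x + 2 * n * k = u := by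
        rcases lt_trichotomy (x + 2 * n * k) u with hl | hl | hl
        · exact (hu3 _ (by omega) hl h5).elim
        · exact hl
        · exact (hx3 _ (by omega) (by omega) h5').elim
      refine Or.inl ⟨x, k, own1 x y hx3 hx4 hx1 hx2, ?_⟩
      rw [h6]
      exact own1 u z hu3 hu4 hu1 hu2
  · intro H
    have nz : ∀ x y, Own (Sf (fR n r)) x y → r x y := by
      intro x y hxy
      have hy : ¬ r (y - n) y := fun hy => own0 y hy _ hxy
      obtain ⟨u, hu1, hu2, hu3, hu4⟩ := h.exists_first y hy hn
      have := (own1 u y hu3 hu4 hu1 hu2).unique hxy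
      rwa [← this]
    rcases H with ⟨x, k, h1, h2⟩ | ⟨h1, h2⟩
    · have e1 := nz _ _ h1
      have e2 := nz _ _ h2
      exact h.trans _ _ _ (h.symm _ _ e1) (h.trans _ _ _ (shk k x) e2)
    · have zz : ∀ y, (∀ x, ¬ Own (Sf (fR n r)) x y) → r y (y + n) := by
        intro y hy
        apply h.zero_of
        by_contra hc
        obtain ⟨u, hu1, hu2, hu3, hu4⟩ := h.exists_first y hc hn
        exact hy u (own1 u y hu3 hu4 hu1 hu2)
      exact h.zero _ _ (zz y h1) (zz z h2)

section Bridge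
variable {n : ℕ}

def toF (hn : 0 < n) (x : ℤ) : Fin (2 * n) :=
  ⟨(x % (2 * n)).toNat, by
    have h1 := Int.emod_nonneg x (b := 2 * n) (by omega)
    have h2 := Int.emod_lt_of_pos x (b := 2 * n) (by omega)
    omega⟩

lemma toF_val (hn : 0 < n) (x : ℤ) : ((toF hn x).val : ℤ) = x % (2 * n) := by
  have h1 := Int.emod_nonneg x (b := 2 * n) (by omega)
  simp only [toF]; omega

lemma toF_eq (hn : 0 < n) (x y : ℤ) : toF hn x = toF hn y ↔ x % (2 * n) = y % (2 * n) := by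
  rw [← toF_val hn, ← toF_val hn, Fin.ext_iff]; omega

lemma toF_coe (hn : 0 < n) (i : Fin (2 * n)) : toF hn (i.val : ℤ) = i := by
  rw [Fin.ext_iff]
  have := toF_val hn i.val
  have h := i.isLt
  rw [Int.emod_eq_of_lt (by omega) (by omega)] at this
  omega

lemma toF_small (hn : 0 < n) (x : ℤ) (h0 : 0 ≤ x) (h1 : x < 2 * n) : ((toF hn x).val : ℤ) = x := by
  rw [toF_val, Int.emod_eq_of_lt h0 h1]

lemma toF_add (hn : 0 < n) (x k : ℤ) : toF hn (x + 2 * n * k) = toF hn x := by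
  rw [toF_eq, Int.add_mul_emod_self_left]

lemma toF_neg (hn : 0 < n) (x : ℤ) : toF hn (x + n) = negB (toF hn x) := by
  rw [Fin.ext_iff]
  have h1 := toF_val hn (x + n)
  have h2 := toF_val hn x
  simp only [negB]
  zify
  rw [h1, h2, Int.emod_add_emod]

lemma negB_invol (hn : 0 < n) (i : Fin (2 * n)) : negB (negB i) = i := by
  rw [← toF_coe hn i, ← toF_neg, ← toF_neg]
  have := toF_add hn i 1
  rwa [show (i : ℤ) + 2 * n * 1 = i + n + n by ring] at this

def rP (hn : 0 < n) (π : Finpartition (Finset.univ : Finset (Fin (2 * n)))) (x y : ℤ) : Prop :=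
  π.part (toF hn x) = π.part (toF hn y)

lemma part_eq_iff_s12 (π : Finpartition (Finset.univ : Finset (Fin (2 * n)))) (i j : Fin (2 * n)) :
    π.part i = π.part j ↔ i ∈ π.part j :=
  (π.mem_part_iff_part_eq_part (Finset.mem_univ _) (Finset.mem_univ _)).symm

lemma exists_part (π : Finpartition (Finset.univ : Finset (Fin (2 * n)))) {B} (hB : B ∈ π.parts) :
    ∃ i, B = π.part i := by
  obtain ⟨i, hi⟩ := π.nonempty_of_mem_parts hB
  exact ⟨i, (π.part_eq_of_mem hB hi).symm⟩

lemma mem_NCB (π : Finpartition (Finset.univ : Finset (Fin (2 * n)))) :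
    π ∈ NCB n ↔ IsNoncrossing π ∧ (∀ B ∈ π.parts, negBlock B ∈ π.parts) ∧
    (π.parts.filter (fun B => negBlock B = B)).card ≤ 1 := by
  simp [NCB, fil]

lemma good_of_NCB (hn : 0 < n) {π : Finpartition (Finset.univ : Finset (Fin (2 * n)))} (hπ : π ∈ NCB n) :
    Good n (rP hn π) := by
  rw [mem_NCB] at hπ
  obtain ⟨hnc, hneg, hz⟩ := hπ
  have hpart : ∀ i, π.part i ∈ π.parts := fun i => π.part_mem.2 (Finset.mem_univ _)
  have hself : ∀ i, i ∈ π.part i := fun i => π.mem_part (Finset.mem_univ _)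
  have neg : ∀ i, π.part (negB i) = negBlock (π.part i) := by
    intro i
    apply π.part_eq_of_mem (hneg _ (hpart i))
    exact Finset.mem_image_of_mem _ (hself i)
  have nc4 : ∀ a b c d : Fin (2 * n), a < b → b < c → c < d → π.part a = π.part c →
      π.part b = π.part d → π.part a = π.part b := by
    intro a b c d h1 h2 h3 h4 h5
    exact hnc a b c d h1 h2 h3 _ (hpart a) _ (hpart b) (hself a) (h4 ▸ hself c) (hself b) (h5 ▸ hself d)
  -- linear version on integers
  have ncl : ∀ a b c d : ℤ, 0 ≤ a → a < b → b < c → c < d → d < 2 * n → rP hn π a c → rP hn π b d →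
      rP hn π a b := by
    intro a b c d h0 h1 h2 h3 h4 h5 h6
    have ea := toF_small hn a (by omega) (by omega)
    have eb := toF_small hn b (by omega) (by omega)
    have ec := toF_small hn c (by omega) (by omega)
    have ed := toF_small hn d (by omega) (by omega)
    exact nc4 _ _ _ _ (by rw [Fin.lt_def]; omega) (by rw [Fin.lt_def]; omega)
      (by rw [Fin.lt_def]; omega) h5 h6
  have red : ∀ x y k l : ℤ, rP hn π (x + 2 * n * k) (y + 2 * n * l) ↔ rP hn π x y := by
    intro x y k l
    simp only [rP, toF_add]
  refine ⟨fun x => rfl, fun x y h => Eq.symm h, fun x y z h h' => Eq.trans h h', ?_, ?_, ?_, ?_⟩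
  · intro x
    have := (red x x 0 1).2 rfl
    simpa using this
  · intro x y h
    simp only [rP, toF_neg, neg] at h ⊢
    rw [h]
  · intro x y hx hy
    simp only [rP, toF_neg, neg] at hx hy ⊢
    rw [Finset.card_le_one] at hz
    exact hz _ (by simp [hpart, ← hx]) _ (by simp [hpart, ← hy])
  · intro a b c d h1 h2 h3 h4 hac hbd
    obtain ⟨q, hq⟩ : ∃ q : ℤ, a % (2 * n) = a + 2 * n * q := ⟨-(a / (2 * n)), by
      have := Int.mul_ediv_add_emod a (2 * n)
      rw [mul_neg]; omega⟩
    have h5 := Int.emod_nonneg a (b := 2 * n) (by omega)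
    have h6 := Int.emod_lt_of_pos a (b := 2 * n) (by omega)
    rw [hq] at h5 h6
    rw [← red _ _ q q] at hac hbd ⊢
    have key : ∀ a b c d : ℤ, 0 ≤ a → a < 2 * n → a < b → b < c → c < d → d < a + 2 * n → rP hn π a c →
        rP hn π b d → rP hn π a b := by
      intro a b c d h0 h0' h1 h2 h3 h4 hac hbd
      have sh : ∀ x y, rP hn π x y → rP hn π (x - 2 * n) y := by
        intro x y h
        rw [← red x y (-1) 0] at h
        simpa [sub_eq_add_neg] using h
      by_cases hd : d < 2 * n
      · exact ncl a b c d h0 h1 h2 h3 hd hac hbd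
      have hdb := sh _ _ hbd.symm
      by_cases hc : c < 2 * n
      · have := ncl (d - 2 * n) a b c (by omega) (by omega) h1 h2 hc hdb hac
        exact this.symm.trans hdb
      have hca := sh _ _ hac.symm
      by_cases hb : b < 2 * n
      · have := ncl (c - 2 * n) (d - 2 * n) a b (by omega) (by omega) (by omega) h1 hb hca hdb
        exact hca.symm.trans (this.trans hdb)
      have hbd' := sh _ _ hdb.symm
      have := ncl (b - 2 * n) (c - 2 * n) (d - 2 * n) a (by omega) (by omega) (by omega) (by omega) (by omega) hbd' hca
      exact hca.symm.trans (this.symm.trans (hbd'.trans hdb))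
    exact key _ _ _ _ h5 h6 (by omega) (by omega) (by omega) (by omega) hac hbd

lemma neg_part (hn : 0 < n) {π : Finpartition (Finset.univ : Finset (Fin (2 * n)))}
    (h : Good n (rP hn π)) (x : ℤ) : negBlock (π.part (toF hn x)) = π.part (toF hn (x + n)) := by
  have sh : ∀ i j, i ∈ π.part j → negB i ∈ π.part (negB j) := by
    intro i j hij
    rw [← part_eq_iff_s12] at hij ⊢
    have := h.shift i j (by simpa only [rP, toF_coe] using hij)
    simpa only [rP, toF_neg, toF_coe] using this
  rw [toF_neg]
  ext j
  simp only [negBlock, Finset.mem_image]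
  constructor
  · rintro ⟨i, hi, rfl⟩
    exact sh _ _ hi
  · intro hj
    refine ⟨negB j, ?_, negB_invol hn j⟩
    have := sh _ _ hj
    rwa [negB_invol hn] at this

lemma NCB_of_good (hn : 0 < n) {π : Finpartition (Finset.univ : Finset (Fin (2 * n)))}
    (h : Good n (rP hn π)) : π ∈ NCB n := by
  have hpart : ∀ i, π.part i ∈ π.parts := fun i => π.part_mem.2 (Finset.mem_univ _)
  rw [mem_NCB]
  refine ⟨?_, ?_, ?_⟩
  · intro a b c d h1 h2 h3 B hB C hC ha hc hb hd
    have ea := π.part_eq_of_mem hB ha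
    have ec := π.part_eq_of_mem hB hc
    have eb := π.part_eq_of_mem hC hb
    have ed := π.part_eq_of_mem hC hd
    have := h.nc a b c d (by exact_mod_cast h1) (by exact_mod_cast h2) (by exact_mod_cast h3)
      (by have := d.isLt; omega) (by simp only [rP, toF_coe, ea, ec]) (by simp only [rP, toF_coe, eb, ed])
    simp only [rP, toF_coe] at this
    rw [← ea, ← eb, this]
  · intro B hB
    obtain ⟨i, rfl⟩ := exists_part π hB
    rw [← toF_coe hn i, neg_part hn h]
    exact hpart _
  · rw [Finset.card_le_one]
    intro B hB C hC
    rw [Finset.mem_filter] at hB hC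
    obtain ⟨hB, hB'⟩ := hB
    obtain ⟨hC, hC'⟩ := hC
    obtain ⟨i, rfl⟩ := exists_part π hB
    obtain ⟨j, rfl⟩ := exists_part π hC
    rw [← toF_coe hn i, neg_part hn h] at hB'
    rw [← toF_coe hn j, neg_part hn h] at hC'
    have := h.zero i j hB'.symm hC'.symm
    simpa only [rP, toF_coe] using this

lemma rP_inj (hn : 0 < n) {π π' : Finpartition (Finset.univ : Finset (Fin (2 * n)))}
    (h : ∀ x y, rP hn π x y ↔ rP hn π' x y) : π = π' := by
  have hp : ∀ i, π.part i = π'.part i := by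
    intro i
    ext j
    have := h j i
    simp only [rP, toF_coe] at this
    rw [← part_eq_iff_s12, ← part_eq_iff_s12, this]
  have hpart : ∀ i, π.part i ∈ π.parts := fun i => π.part_mem.2 (Finset.mem_univ _)
  have hpart' : ∀ i, π'.part i ∈ π'.parts := fun i => π'.part_mem.2 (Finset.mem_univ _)
  apply Finpartition.ext
  ext B
  constructor
  · intro hB
    obtain ⟨i, rfl⟩ := exists_part π hB
    rw [hp]; exact hpart' i
  · intro hB
    obtain ⟨i, rfl⟩ := exists_part π' hB
    rw [← hp]; exact hpart i

lemma good_addk {n : ℤ} {r : ℤ → ℤ → Prop} (h : Good n r) (x k : ℤ) : r x (x + 2 * n * k) := by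
  induction k using Int.induction_on with
  | zero => simpa using h.refl x
  | succ i ih =>
    have := h.trans _ _ _ ih (h.per _)
    rwa [show x + 2 * n * i + 2 * n = x + 2 * n * (i + 1) by ring] at this
  | pred i ih =>
    have := h.per (x + 2 * n * (-i - 1))
    rw [show x + 2 * n * (-i - 1) + 2 * n = x + 2 * n * -i by ring] at this
    exact h.trans _ _ _ ih (h.symm _ _ this)

lemma good_mod {n : ℤ} {r : ℤ → ℤ → Prop} (h : Good n r) (x : ℤ) : r x (x % (2 * n)) := by
  have := good_addk h x (-(x / (2 * n)))
  rwa [show x + 2 * n * -(x / (2 * n)) = x % (2 * n) by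
    have := Int.mul_ediv_add_emod x (2 * n)
    rw [mul_neg]; omega] at this

lemma exists_rP (hn : 0 < n) {r : ℤ → ℤ → Prop} (h : Good n r) :
    ∃ π : Finpartition (Finset.univ : Finset (Fin (2 * n))), rP hn π = r := by
  classical
  let s : Setoid (Fin (2 * n)) := ⟨fun i j => r i j, fun i => h.refl _, fun {i j} => h.symm _ _,
    fun {i j k} => h.trans _ _ _⟩
  refine ⟨Finpartition.ofSetoid s, ?_⟩
  funext x y
  apply propext
  rw [rP, part_eq_iff_s12, Finpartition.mem_part_ofSetoid_iff_rel]
  change r _ _ ↔ _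
  rw [toF_val, toF_val]
  constructor
  · intro H
    exact h.symm _ _ (h.trans _ _ _ (good_mod h y) (h.trans _ _ _ H (h.symm _ _ (good_mod h x))))
  · intro H
    exact h.trans _ _ _ (h.symm _ _ (good_mod h y)) (h.trans _ _ _ (h.symm _ _ H) (good_mod h x))

lemma first_of_pos {n : ℤ} {r : ℤ → ℤ → Prop} {x : ℤ} (h : 0 < fR n r x) :
    IsFirst n r x ∧ (blk n r x).card = fR n r x := by
  unfold fR at *
  split_ifs at * with H
  · exact ⟨H, rfl⟩
  · omega

lemma card_part (hn : 0 < n) {π : Finpartition (Finset.univ : Finset (Fin (2 * n)))}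
    (h : Good n (rP hn π)) {x : ℤ} (hx : IsFirst n (rP hn π) x) :
    (π.part (toF hn x)).card = (blk n (rP hn π) x).card := by
  symm
  apply Finset.card_bij (fun y _ => toF hn y)
  · intro y hy
    simp only [blk, Finset.mem_filter] at hy
    rw [← part_eq_iff_s12]
    exact hy.2.symm
  · intro a ha b hb hab
    simp only [blk, Finset.mem_filter, Finset.mem_Ico] at ha hb
    rw [toF_eq] at hab
    obtain ⟨k, hk⟩ := (Int.ModEq.dvd (hab : a % (2 * n) = b % (2 * n)) : (2 * n : ℤ) ∣ b - a)
    rcases mulcases n k (by omega) with rfl | rfl | h5 | h5 <;> omega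
  · intro j hj
    rw [← part_eq_iff_s12] at hj
    have e0 := Int.mul_ediv_add_emod ((j : ℤ) - x + n) (2 * n)
    have e1 := Int.emod_nonneg ((j : ℤ) - x + n) (b := 2 * n) (by omega)
    have e2 := Int.emod_lt_of_pos ((j : ℤ) - x + n) (b := 2 * n) (by omega)
    set q := ((j : ℤ) - x + n) / (2 * n) with hq
    have e3 : toF hn ((j : ℤ) + 2 * n * (-q)) = j := by rw [toF_add, toF_coe]
    have e4 : rP hn π ((j : ℤ) + 2 * n * (-q)) x := by
      rw [rP, e3]; exact hj
    refine ⟨(j : ℤ) + 2 * n * (-q), ?_, e3⟩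
    simp only [blk, Finset.mem_filter, Finset.mem_Ico]
    rw [mul_neg] at *
    refine ⟨⟨?_, by omega⟩, h.symm _ _ e4⟩
    by_contra hc
    exact hx _ (by omega) (by omega) e4

lemma card_blocks (hn : 0 < n) {π : Finpartition (Finset.univ : Finset (Fin (2 * n)))}
    (h : Good n (rP hn π)) {t : ℕ} (ht : 0 < t) :
    (π.parts.filter (fun B => negBlock B ≠ B ∧ B.card = t)).card =
      ((Finset.Ico (0 : ℤ) (2 * n)).filter (fun x => fR n (rP hn π) x = t)).card := by
  have hn' : (0 : ℤ) < n := by omega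
  symm
  apply Finset.card_bij (fun x _ => π.part (toF hn x))
  · intro x hx
    simp only [Finset.mem_filter, Finset.mem_Ico] at hx
    obtain ⟨h1, h2⟩ := first_of_pos (hx.2 ▸ ht)
    rw [Finset.mem_filter]
    refine ⟨π.part_mem.2 (Finset.mem_univ _), ?_, ?_⟩
    · rw [neg_part hn h]
      intro H
      apply h.first_notzero hn' h1
      have : rP hn π x (x + n) := H.symm
      rw [← h.shift_iff]
      simpa using this
    · rw [card_part hn h h1, h2, hx.2]
  · intro a ha b hb hab
    simp only [Finset.mem_filter, Finset.mem_Ico] at ha hb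
    have fa := (first_of_pos (ha.2 ▸ ht)).1
    have fb := (first_of_pos (hb.2 ▸ ht)).1
    have key : ∀ a b : ℤ, 0 ≤ a → b < 2 * n → a < b → IsFirst n (rP hn π) a → IsFirst n (rP hn π) b →
        ¬ rP hn π a b := by
      intro a b h1 h2 h3 fa fb H
      by_cases hc : b - a ≤ n
      · exact fb a (by omega) h3 H
      · refine fa (b - 2 * n) (by omega) (by omega) ?_
        have := h.per (b - 2 * n)
        rw [sub_add_cancel] at this
        exact h.trans _ _ _ this (h.symm _ _ H)
    rcases lt_trichotomy a b with hl | hl | hl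
    · exact (key a b ha.1.1 hb.1.2 hl fa fb hab).elim
    · exact hl
    · exact (key b a hb.1.1 ha.1.2 hl fb fa hab.symm).elim
  · intro B hB
    rw [Finset.mem_filter] at hB
    obtain ⟨hB, hz, hc⟩ := hB
    obtain ⟨i, rfl⟩ := exists_part π hB
    have hi : ¬ rP hn π ((i : ℤ) - n) i := by
      intro H
      have H := h.zero_of H
      apply hz
      have e := neg_part hn h i
      rw [toF_coe] at e
      rw [e]
      simp only [rP, toF_coe] at H
      exact H.symm
    obtain ⟨x, hx1, hx2, hx3, hx4⟩ := h.exists_first i hi hn'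
    have hcard := card_part hn h hx3
    have hpe : π.part (toF hn x) = π.part i := by simpa only [rP, toF_coe] using hx4
    rw [hpe, hc] at hcard
    have hfx : fR n (rP hn π) x = t := by
      unfold fR; rw [if_pos hx3, ← hcard]
    have hil := i.isLt
    by_cases hx0 : 0 ≤ x
    · refine ⟨x, ?_, hpe⟩
      simp only [Finset.mem_filter, Finset.mem_Ico]
      exact ⟨by omega, hfx⟩
    · refine ⟨x + n + n, ?_, ?_⟩
      · simp only [Finset.mem_filter, Finset.mem_Ico]
        exact ⟨by omega, by rw [h.fR_shift, h.fR_shift, hfx]⟩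
      · have := toF_add hn x 1
        rw [show x + n + n = x + 2 * n * 1 by ring, this, hpe]

lemma card_fin (P : ℤ → Prop) [DecidablePred P] :
    ((Finset.Ico (0 : ℤ) n).filter P).card = ((Finset.univ : Finset (Fin n)).filter (fun i => P i.val)).card := by
  symm
  apply Finset.card_bij (fun i _ => (i.val : ℤ))
  · intro i hi
    have := i.isLt
    simp only [Finset.mem_filter, Finset.mem_Ico, Finset.mem_univ, true_and] at hi ⊢
    exact ⟨by omega, hi⟩
  · intro a _ b _ hab
    rw [Fin.ext_iff]; omega
  · intro x hx
    simp only [Finset.mem_filter, Finset.mem_Ico] at hx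
    refine ⟨⟨x.toNat, by omega⟩, ?_, ?_⟩
    · simp only [Finset.mem_filter, Finset.mem_univ, true_and]
      rw [Int.toNat_of_nonneg hx.1.1]; exact hx.2
    · simp only; omega

lemma sum_fin (g : ℤ → ℕ) :
    ∑ z ∈ Finset.Ico (0 : ℤ) n, (g z : ℤ) = ((∑ i : Fin n, g i.val : ℕ) : ℤ) := by
  push_cast
  symm
  apply Finset.sum_bij (fun i _ => (i.val : ℤ))
  · intro i hi
    have := i.isLt
    simp only [Finset.mem_Ico]
    omega
  · intro a _ b _ hab
    rw [Fin.ext_iff]; omega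
  · intro x hx
    simp only [Finset.mem_Ico] at hx
    exact ⟨⟨x.toNat, by omega⟩, Finset.mem_univ _, by simp only; omega⟩
  · intro i _; rfl

lemma pairCount_eq (hn : 0 < n) {π : Finpartition (Finset.univ : Finset (Fin (2 * n)))}
    (h : Good n (rP hn π)) {t : ℕ} (ht : 0 < t) :
    pairCount π t = ((Finset.univ : Finset (Fin n)).filter (fun i => fR n (rP hn π) i.val = t)).card := by
  unfold pairCount
  rw [card_blocks hn h ht, ← card_fin (fun x => fR n (rP hn π) x = t)]
  have e1 : Finset.Ico (0 : ℤ) (2 * n) = Finset.Ico (0 : ℤ) n ∪ Finset.Ico (n : ℤ) (2 * n) := by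
    ext; simp; omega
  have e2 : ((Finset.Ico (n : ℤ) (2 * n)).filter (fun x => fR n (rP hn π) x = t)).card =
      ((Finset.Ico (0 : ℤ) n).filter (fun x => fR n (rP hn π) x = t)).card := by
    symm
    apply Finset.card_bij (fun (x : ℤ) _ => x + (n : ℤ))
    · intro x hx
      simp only [Finset.mem_filter, Finset.mem_Ico] at hx ⊢
      exact ⟨by omega, by rw [h.fR_shift, hx.2]⟩
    · intro a _ b _ hab; simpa using hab
    · intro x hx
      simp only [Finset.mem_filter, Finset.mem_Ico] at hx ⊢
      refine ⟨x - n, ⟨by omega, ?_⟩, by ring⟩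
      rw [← h.fR_shift, sub_add_cancel, hx.2]
  rw [e1, Finset.filter_union, Finset.card_union_of_disjoint, e2]
  · omega
  · apply Finset.disjoint_filter_filter
    rw [Finset.disjoint_left]
    intro a; simp; omega

lemma periodic_mod (g : ℤ → ℕ) (n : ℤ) (hg : ∀ x, g (x + n) = g x) (x : ℤ) : g (x % n) = g x := by
  have key : ∀ k : ℤ, ∀ x, g (x + n * k) = g x := by
    intro k
    induction k using Int.induction_on with
    | zero => simp
    | succ i ih => intro x; rw [mul_add, mul_one, ← add_assoc, hg, ih]
    | pred i ih => intro x; rw [← hg, ← ih x]; congr 1; ring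
  have := key (x / n) (x % n)
  rw [Int.emod_add_mul_ediv] at this
  exact this.symm

def extF (hn : 0 < n) (f : Fin n → ℕ) (x : ℤ) : ℕ :=
  f ⟨(x % n).toNat, by
    have h1 := Int.emod_nonneg x (b := n) (by omega)
    have h2 := Int.emod_lt_of_pos x (b := n) (by omega)
    omega⟩

lemma extF_coe (hn : 0 < n) (f : Fin n → ℕ) (i : Fin n) : extF hn f i.val = f i := by
  unfold extF
  congr 1
  have := i.isLt
  rw [Fin.ext_iff]
  simp only
  rw [Int.emod_eq_of_lt (by omega) (by omega)]; omega

lemma extF_add (hn : 0 < n) (f : Fin n → ℕ) (x : ℤ) : extF hn f (x + n) = extF hn f x := by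
  unfold extF
  simp only [Int.add_emod_right]

def TT (n : ℕ) : Finset (Fin n → ℕ) :=
  (Fintype.piFinset (fun _ => Finset.range (n + 1))).filter (fun f => ∑ i, f i ≤ n)

lemma mem_TT (f : Fin n → ℕ) : f ∈ TT n ↔ ∑ i, f i ≤ n := by
  simp only [TT, Finset.mem_filter, Fintype.mem_piFinset, Finset.mem_range, and_iff_right_iff_imp]
  intro h i
  have := Finset.single_le_sum (f := f) (fun _ _ => Nat.zero_le _) (Finset.mem_univ i)
  omega

lemma card_TT (i : Fin n) (t : ℕ) (htn : t ≤ n) :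
    ((TT n).filter (fun f => f i = t)).card = Nat.choose (2 * n - t - 1) (n - 1) := by
  have hn : 0 < n := i.pos
  have h1 := Finset.card_finsuppAntidiag_nat_eq_choose (s := (Finset.univ : Finset (Fin n))) (n - t)
  rw [Finset.card_univ, Fintype.card_fin, show n + (n - t) - 1 = 2 * n - t - 1 by omega] at h1
  rw [Nat.choose_symm_of_eq_add (b := n - t) (by omega), ← h1]
  have upd : ∀ (f : Fin n → ℕ) (v : ℕ), ∑ j, Function.update f i v j + f i = ∑ j, f j + v := by
    intro f v
    rw [Finset.sum_update_of_mem (Finset.mem_univ i), ← Finset.sum_sdiff (Finset.subset_univ {i}) (f := f)]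
    simp; ring
  apply Finset.card_bij (fun f _ => Finsupp.equivFunOnFinite.symm (Function.update f i (n - ∑ j, f j)))
  · intro f hf
    rw [Finset.mem_filter, mem_TT] at hf
    rw [Finset.mem_finsuppAntidiag]
    refine ⟨?_, Finset.subset_univ _⟩
    have := upd f (n - ∑ j, f j)
    simp only [Finsupp.equivFunOnFinite_symm_apply_apply]
    omega
  · intro f hf g hg hfg
    rw [Finset.mem_filter] at hf hg
    have e := Finsupp.equivFunOnFinite.symm.injective hfg
    funext j
    by_cases hj : j = i
    · subst hj; rw [hf.2, hg.2]
    · have := congrFun e j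
      simpa [hj] using this
  · intro g hg
    rw [Finset.mem_finsuppAntidiag] at hg
    have := upd g t
    have h0 : ∑ j, g j = n - t := hg.1
    refine ⟨Function.update g i t, ?_, ?_⟩
    · rw [Finset.mem_filter, mem_TT]
      exact ⟨by omega, by simp⟩
    · rw [Equiv.symm_apply_eq]
      funext j
      by_cases hj : j = i
      · subst hj; simp; omega
      · simp [hj]

end Bridge

/-- The sum, over all type `B_n` non-crossing partitions, of the number of unordered pairs
`{V, -V}` of non-zero blocks with `|V| = t`, equals `n binom(2n-t-1, n-1)`. -/
theorem typeB_sum_pairCount (n t : ℕ) (hn : 1 ≤ n) (ht1 : 1 ≤ t) (htn : t ≤ n) :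
    ∑ π ∈ NCB n, pairCount π t = n * Nat.choose (2 * n - t - 1) (n - 1) := by
  have hn0 : 0 < n := hn
  have hnz : (0 : ℤ) < n := by omega
  have step1 : ∑ π ∈ NCB n, pairCount π t =
      ∑ f ∈ TT n, ((Finset.univ : Finset (Fin n)).filter (fun i => f i = t)).card := by
    apply Finset.sum_bij (fun π _ => fun i : Fin n => fR n (rP hn0 π) i.val)
    · intro π hπ
      have hg := good_of_NCB hn0 hπ
      have := hg.sum_period hnz
      rw [sum_fin] at this
      rw [mem_TT]
      exact_mod_cast this
    · intro π hπ π' hπ' heq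
      have hg := good_of_NCB hn0 hπ
      have hg' := good_of_NCB hn0 hπ'
      have hF : fR n (rP hn0 π) = fR n (rP hn0 π') := by
        funext x
        have h1 := Int.emod_nonneg x (b := n) (by omega)
        have h2 := Int.emod_lt_of_pos x hnz
        rw [← periodic_mod _ n hg.fR_shift, ← periodic_mod _ n hg'.fR_shift]
        have := congrFun heq ⟨(x % n).toNat, by omega⟩
        simpa [Int.toNat_of_nonneg h1] using this
      apply rP_inj hn0
      intro x y
      rw [hg.rel_eq hnz, hg'.rel_eq hnz, hF]
    · intro f hf
      rw [mem_TT] at hf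
      have hW := Sf_walk n hnz (extF hn0 f) (extF_add hn0 f) (by
        rw [sum_fin]
        simp only [extF_coe]
        exact_mod_cast hf)
      obtain ⟨π, hπ⟩ := exists_rP hn0 hW.good
      refine ⟨π, NCB_of_good hn0 (hπ ▸ hW.good), ?_⟩
      funext i
      rw [hπ, hW.fR_eq, extF_coe]
    · intro π hπ
      exact pairCount_eq hn0 (good_of_NCB hn0 hπ) ht1
  rw [step1]
  simp only [Finset.card_filter]
  rw [Finset.sum_comm]
  simp only [← Finset.card_filter]
  rw [Finset.sum_congr rfl (fun i _ => card_TT i t htn)]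
  simp
end

section
/- Let n ≥ 1 and 1 ≤ t ≤ n be integers. The number of partitions π in NC_B(n) that have a zero-block of cardinality 2t equals binom(2n − t − 1, n − 1). -/
open Finset

namespace TB
open Classical in
/-- number of elements in the block opened at `j` -/
noncomputable def cnt (n : ℕ) (O : ℤ → ℤ → Prop) (j : ℤ) : ℕ :=
  ((Finset.Ico j (j + n)).filter (fun x => O j x)).card

/-- axioms of an opener relation -/
structure OAx (n : ℕ) (O : ℤ → ℤ → Prop) : Prop where
  rng : ∀ j x, O j x → j ≤ x ∧ x < j + n
  uniq : ∀ i j x, O i x → O j x → i = j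
  shift : ∀ j x, O (j + n) (x + n) ↔ O j x
  nc : ∀ j x i z, O j x → O i z → j < i → i ≤ x → z ≤ x
  zero : ∀ x, (∀ j, ¬ O j x) → ∀ i z, O i z → i ≤ x → z < x

/-- opener relation of a height function -/
def OS (S : ℤ → ℤ) (j x : ℤ) : Prop :=
  j ≤ x ∧ S j ≤ S (x + 1) ∧ ∀ y, j < y → y ≤ x → S (x + 1) < S y

theorem S_diff (S : ℤ → ℤ) (s : ℤ → ℕ) (hS : ∀ x, S (x + 1) = S x + s x - 1) (y : ℤ) (d : ℕ) :
    S (y + d) = S y + ∑ i ∈ Finset.Ico y (y + d), (s i : ℤ) - d := by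
  induction d with
  | zero => simp
  | succ d ih =>
    have h : Finset.Ico y (y + (d + 1 : ℕ)) = insert (y + d) (Finset.Ico y (y + d)) := by
      ext z; simp; omega
    rw [h, Finset.sum_insert (by simp)]
    have := hS (y + d)
    push_cast
    rw [← add_assoc, this, ih]; ring

theorem S_diff' (S : ℤ → ℤ) (s : ℤ → ℕ) (hS : ∀ x, S (x + 1) = S x + s x - 1) (y x : ℤ)
    (h : y ≤ x) :
    S (x + 1) = S y + ((∑ i ∈ Finset.Ico y (x + 1), s i : ℕ) : ℤ) - (x + 1 - y) := by
  obtain ⟨d, hd⟩ : ∃ d : ℕ, x + 1 = y + d := ⟨(x + 1 - y).toNat, by omega⟩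
  rw [hd, S_diff S s hS]; push_cast; omega

theorem sum_le (n : ℕ) (O : ℤ → ℤ → Prop) (h : OAx n O) (A B : Finset ℤ)
    (hAB : ∀ i ∈ A, ∀ z, O i z → z ∈ B) : ∑ i ∈ A, cnt n O i ≤ B.card := by
  classical
  unfold cnt
  rw [← Finset.card_biUnion]
  · apply Finset.card_le_card
    intro z hz
    simp only [Finset.mem_biUnion, Finset.mem_filter] at hz
    obtain ⟨i, hi, _, hz⟩ := hz
    exact hAB i hi z hz
  · intro i _ j _ hij
    rw [Function.onFun, Finset.disjoint_left]
    intro z h1 h2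
    simp only [Finset.mem_filter] at h1 h2
    exact hij (h.uniq _ _ _ h1.2 h2.2)

theorem le_sum (n : ℕ) (O : ℤ → ℤ → Prop) (h : OAx n O) (A B : Finset ℤ)
    (hAB : ∀ z ∈ B, ∃ i ∈ A, O i z) : B.card ≤ ∑ i ∈ A, cnt n O i := by
  classical
  unfold cnt
  refine le_trans (Finset.card_le_card ?_) Finset.card_biUnion_le
  intro z hz
  obtain ⟨i, hi, hz⟩ := hAB z hz
  simp only [Finset.mem_biUnion, Finset.mem_filter, Finset.mem_Ico]
  exact ⟨i, hi, h.rng _ _ hz, hz⟩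

theorem OS_eq (n : ℕ) (O : ℤ → ℤ → Prop) (h : OAx n O) (S : ℤ → ℤ)
    (hS : ∀ x, S (x + 1) = S x + cnt n O x - 1) (j x : ℤ) : OS S j x ↔ O j x := by
  have key : ∀ y x, y ≤ x → (∀ i z, y ≤ i → i ≤ x → O i z → z < x) → S (x + 1) < S y := by
    intro y x hyx H
    have h1 := sum_le n O h (Finset.Ico y (x + 1)) (Finset.Ico y x) (by
      intro i hi z hz
      simp only [Finset.mem_Ico] at *
      have := H i z hi.1 (by omega) hz
      have := h.rng _ _ hz
      omega)
    have h2 := S_diff' S _ hS y x hyx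
    simp only [Int.card_Ico] at h1
    omega
  have fwd : ∀ j x, O j x → OS S j x := by
    intro j x hj
    have hr := h.rng _ _ hj
    refine ⟨hr.1, ?_, ?_⟩
    · have h2 := S_diff' S _ hS j x hr.1
      have h1 := le_sum n O h (Finset.Ico j (x + 1)) (Finset.Ico j (x + 1)) (by
        intro z hz
        simp only [Finset.mem_Ico] at *
        by_cases hz0 : ∀ i, ¬ O i z
        · have := h.zero z hz0 j x hj hz.1
          omega
        · push Not at hz0
          obtain ⟨i, hi⟩ := hz0
          have hri := h.rng _ _ hi
          refine ⟨i, ⟨?_, by omega⟩, hi⟩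
          by_contra hlt
          have := h.nc i z j x hi hj (by omega) (by omega)
          have e : x = z := by omega
          subst e
          have := h.uniq _ _ _ hi hj
          omega)
      simp only [Int.card_Ico] at h1
      omega
    · intro y hy hyx
      apply key y x hyx
      intro i z hi hix hz
      have := h.nc j x i z hj hz (by omega) hix
      rcases lt_or_eq_of_le this with h' | h'
      · exact h'
      · subst h'
        have := h.uniq _ _ _ hz hj
        omega
  refine ⟨fun hs => ?_, fwd j x⟩
  by_cases hz0 : ∀ i, ¬ O i x
  · have := key j x hs.1 (fun i z _ hix hz => h.zero x hz0 i z hz hix)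
    have := hs.2.1
    omega
  · push Not at hz0
    obtain ⟨i, hi⟩ := hz0
    have hi' := fwd i x hi
    rcases lt_trichotomy i j with h' | h' | h'
    · have := hi'.2.2 j h' hs.1
      have := hs.2.1
      omega
    · exact h' ▸ hi
    · have := hs.2.2 i h' hi'.1
      have := hi'.2.1
      omega

/-- A height function exists. -/
theorem exists_S (s : ℤ → ℕ) : ∃ S : ℤ → ℤ, ∀ x, S (x + 1) = S x + s x - 1 := by
  refine ⟨fun x => ∑ i ∈ Finset.Ico 0 x, ((s i : ℤ) - 1) - ∑ i ∈ Finset.Ico x 0, ((s i : ℤ) - 1), ?_⟩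
  intro x
  dsimp only
  rcases le_or_gt 0 x with h | h
  · have e1 : Finset.Ico 0 (x + 1) = insert x (Finset.Ico 0 x) := by ext z; simp; omega
    have e2 : Finset.Ico (x + 1) 0 = ∅ := by ext z; simp; omega
    have e3 : Finset.Ico x 0 = ∅ := by ext z; simp; omega
    rw [e1, e2, e3, Finset.sum_insert (by simp)]; simp; ring
  · have e1 : Finset.Ico x 0 = insert x (Finset.Ico (x + 1) 0) := by ext z; simp; omega
    have e2 : Finset.Ico 0 (x + 1) = ∅ := by ext z; simp; omega
    have e3 : Finset.Ico 0 x = ∅ := by ext z; simp; omega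
    rw [e1, e2, e3, Finset.sum_insert (by simp)]; simp; ring

theorem sum_shift (n : ℕ) (f : ℤ → ℕ) (hf : ∀ x, f (x + n) = f x) (a : ℤ) :
    ∑ i ∈ Finset.range n, f (a + i) = ∑ i ∈ Finset.range n, f i := by
  have step : ∀ a : ℤ, ∑ i ∈ Finset.range n, f (a + 1 + i) = ∑ i ∈ Finset.range n, f (a + i) := by
    intro a
    have h1 := Finset.sum_range_succ (fun i : ℕ => f (a + i)) n
    have h2 := Finset.sum_range_succ' (fun i : ℕ => f (a + i)) n
    simp only [hf] at h1
    have : ∀ i : ℕ, f (a + (i + 1 : ℕ)) = f (a + 1 + i) := by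
      intro i; congr 1; push_cast; ring
    simp only [this] at h2
    simp only [Nat.cast_zero, add_zero] at h2
    omega
  induction a using Int.induction_on with
  | zero => simp
  | succ a ih => rw [step, ih]
  | pred a ih => rw [← ih, ← step]; simp

theorem Ico_sum (n : ℕ) (f : ℤ → ℕ) (a : ℤ) :
    ∑ i ∈ Finset.Ico a (a + n), f i = ∑ i ∈ Finset.range n, f (a + i) := by
  symm
  apply Finset.sum_bij (fun (i : ℕ) _ => a + (i : ℤ))
  · intro i hi; simp at *; omega
  · intro i _ j _ h; omega
  · intro b hb; simp at hb; exact ⟨(b - a).toNat, by simp; omega, by omega⟩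
  · intros; rfl

/-- nonzero elements in a period -/
theorem sum_cnt (n : ℕ) (O : ℤ → ℤ → Prop) (h : OAx n O) :
    open Classical in
    ∑ i ∈ Finset.range n, cnt n O i + ((Finset.range n).filter (fun x : ℕ => ∀ j, ¬ O j x)).card
      = n := by
  classical
  have h1 : ∀ j : ℤ, cnt n O j = ∑ d ∈ Finset.range n, if O j (j + d) then 1 else 0 := by
    intro j
    rw [cnt, Finset.card_filter, Ico_sum]
  have h2 : ∑ i ∈ Finset.range n, cnt n O i =
      ((Finset.range n).filter (fun x : ℕ => ¬ ∀ j, ¬ O j x)).card := by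
    simp only [h1]
    rw [Finset.sum_comm]
    have : ∀ d : ℕ, (∑ x ∈ Finset.range n, if O x ((x : ℤ) + d) then 1 else 0) =
        ∑ x ∈ Finset.range n, if O ((x : ℤ) - d) x then 1 else 0 := by
      intro d
      have := sum_shift n (fun x => if O x (x + d) then 1 else 0) (by
        intro x
        have := h.shift x (x + d)
        rw [show x + d + (n : ℤ) = x + n + d by ring] at this
        simp only [this]) (-d)
      rw [← this]
      apply Finset.sum_congr rfl
      intro x _
      have e1 : -(d : ℤ) + x = x - d := by ring
      have e2 : -(d : ℤ) + x + d = x := by ring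
      rw [e1, sub_add_cancel]
    simp only [this]
    rw [Finset.sum_comm, Finset.card_filter]
    apply Finset.sum_congr rfl
    intro x _
    rw [← Finset.card_filter]
    by_cases hx : ∀ j, ¬ O j x
    · rw [if_neg (not_not.mpr hx), Finset.card_eq_zero, Finset.filter_eq_empty_iff]
      intro d _
      exact hx _
    · rw [if_pos hx]
      push Not at hx
      obtain ⟨j, hj⟩ := hx
      have hr := h.rng _ _ hj
      rw [Finset.card_eq_one]
      refine ⟨(x - j).toNat, ?_⟩
      ext d
      simp only [Finset.mem_filter, Finset.mem_range, Finset.mem_singleton]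
      constructor
      · rintro ⟨_, hd⟩
        have := h.uniq _ _ _ hj hd
        omega
      · rintro rfl
        refine ⟨by omega, ?_⟩
        convert hj using 1
        omega
  rw [h2, add_comm, Finset.card_filter_add_card_filter_not]
  simp

/-- the height function of a function with drift gives an opener relation -/
theorem OS_ax (n : ℕ) (S : ℤ → ℤ) (t : ℤ) (ht : 1 ≤ t)
    (hper : ∀ x, S (x + n) = S x - t) : OAx n (OS S) where
  rng j x h := by
    refine ⟨h.1, ?_⟩
    by_contra hx
    have hn : n ≠ 0 := by rintro rfl; have := hper 0; simp at this; omega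
    have := h.2.2 (j + n) (by omega) (by omega)
    have := h.2.1
    have := hper j
    omega
  uniq i j x hi hj := by
    rcases lt_trichotomy i j with h' | h' | h'
    · have := hi.2.2 j h' hj.1
      have := hj.2.1
      omega
    · exact h'
    · have := hj.2.2 i h' hi.1
      have := hi.2.1
      omega
  shift j x := by
    have e : S (x + n + 1) = S (x + 1) - t := by rw [← hper]; congr 1; ring
    unfold OS
    rw [hper, e]
    constructor
    · rintro ⟨h1, h2, h3⟩
      refine ⟨by omega, by omega, fun y hy hy' => ?_⟩
      have := h3 (y + n) (by omega) (by omega)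
      rw [hper] at this
      omega
    · rintro ⟨h1, h2, h3⟩
      refine ⟨by omega, by omega, fun y hy hy' => ?_⟩
      have := h3 (y - n) (by omega) (by omega)
      have e := hper (y - n)
      simp only [sub_add_cancel] at e
      omega
  nc j x i z hj hi hji hix := by
    by_contra hx
    have := hi.2.2 (x + 1) (by omega) (by omega)
    have := hi.2.1
    have := hj.2.2 i hji hix
    omega
  zero x hx i z hi hix := by
    have hz : ∀ d : ℕ, S (x + 1) < S (x - d) := by
      intro d
      induction d using Nat.strong_induction_on with
      | _ d ih =>
        by_contra hlt
        apply hx (x - d)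
        refine ⟨by omega, by omega, fun y hy hyx => ?_⟩
        have := ih (x - y).toNat (by omega)
        convert this using 2
        omega
    by_contra hlt
    have hxi := hz (x - i).toNat
    rw [show x - ((x - i).toNat : ℤ) = i by omega] at hxi
    rcases eq_or_ne x z with rfl | hne
    · exact hx _ hi
    · have := hi.2.2 (x + 1) (by omega) (by omega)
      have := hi.2.1
      omega

theorem OS_self (S : ℤ → ℤ) (j x : ℤ) (h : OS S j x) : OS S j j := by
  refine ⟨le_rfl, ?_, fun y h1 h2 => by omega⟩
  rcases eq_or_ne j x with rfl | hne
  · exact h.2.1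
  · have := h.2.2 (j + 1) (by omega) (by have := h.1; omega)
    have := h.2.1
    omega

theorem OS_cnt (n : ℕ) (S : ℤ → ℤ) (s : ℤ → ℕ) (t : ℤ) (ht : 1 ≤ t)
    (hS : ∀ x, S (x + 1) = S x + s x - 1)
    (hper : ∀ x, S (x + n) = S x - t) (j : ℤ) : cnt n (OS S) j = s j := by
  classical
  have ax := OS_ax n S t ht hper
  have hn : n ≠ 0 := by rintro rfl; have := hper 0; simp at this; omega
  have : s j = (Finset.Ico (S j) (S j + s j)).card := by simp
  rw [this, cnt]
  apply Finset.card_bij (fun x _ => S (x + 1))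
  · intro x hx
    simp only [Finset.mem_filter] at hx
    have hx := hx.2
    simp only [Finset.mem_Ico]
    refine ⟨hx.2.1, ?_⟩
    have := hS j
    rcases eq_or_ne j x with rfl | hne
    · omega
    · have := hx.2.2 (j + 1) (by omega) (by have := hx.1; omega)
      omega
  · intro x hx y hy e
    simp only [Finset.mem_filter] at hx hy
    have hx := hx.2
    have hy := hy.2
    rcases lt_trichotomy x y with h' | h' | h'
    · have := hy.2.2 (x + 1) (by have := hx.1; omega) (by omega)
      omega
    · exact h'
    · have := hx.2.2 (y + 1) (by have := hy.1; omega) (by omega)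
      omega
  · intro l hl
    simp only [Finset.mem_Ico] at hl
    have hex : ∃ d : ℕ, S (j + d + 1) ≤ l := ⟨n - 1, by
      have e : j + ((n - 1 : ℕ) : ℤ) + 1 = j + n := by omega
      rw [e, hper]; omega⟩
    have h1 := Nat.find_spec hex
    have h2 := fun m => @Nat.find_min _ _ hex m
    set d := Nat.find hex
    have e : S (j + d + 1) = l := by
      have h3 := hS (j + d)
      rcases Nat.eq_zero_or_pos d with h0 | h0
      · rw [h0] at h1 h3 ⊢
        simp only [Nat.cast_zero, add_zero] at *
        omega
      · have := h2 (d - 1) (by omega)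
        rw [show j + ((d - 1 : ℕ) : ℤ) + 1 = j + d by omega] at this
        omega
    have hO : OS S j (j + d) := by
      refine ⟨by omega, by omega, fun y hy hyx => ?_⟩
      have := h2 (y - 1 - j).toNat (by omega)
      rw [show j + ((y - 1 - j).toNat : ℤ) + 1 = y by omega] at this
      omega
    refine ⟨j + d, ?_, e⟩
    simp only [Finset.mem_filter, Finset.mem_Ico]
    exact ⟨ax.rng _ _ hO, hO⟩
end TB

namespace TB
/-- axioms of the relation on `ℤ` coming from a type B noncrossing partition -/
structure RAx (n : ℕ) (R : ℤ → ℤ → Prop) : Prop where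
  refl : ∀ x, R x x
  symm : ∀ x y, R x y → R y x
  trans : ∀ x y z, R x y → R y z → R x z
  shift : ∀ x y, R x y → R (x + n) (y + n)
  per : ∀ x, R x (x + 2 * n)
  nc : ∀ a b c d : ℤ, a < b → b < c → c < d → d < a + 2 * n → R a c → R b d → R a b
  zero : ∀ x y, R x (x + n) → R y (y + n) → R x y

/-- opener relation of `R` -/
def OR (n : ℕ) (R : ℤ → ℤ → Prop) (j x : ℤ) : Prop :=
  j ≤ x ∧ x < j + n ∧ R j x ∧ ¬ R j (j + n) ∧ ∀ y, j - n < y → y < j → ¬ R y j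

/-- relation of an opener relation -/
def Rel (n : ℕ) (O : ℤ → ℤ → Prop) (x y : ℤ) : Prop :=
  ((∀ j, ¬ O j x) ∧ (∀ j, ¬ O j y)) ∨ ∃ i j, O i x ∧ O j y ∧ (2 * n : ℤ) ∣ j - i

theorem RAx.unshift {n : ℕ} {R : ℤ → ℤ → Prop} (h : RAx n R) (x y : ℤ)
    (hxy : R (x + n) (y + n)) : R x y := by
  have h1 := h.shift _ _ hxy
  have h2 := h.per x
  have h3 := h.per y
  rw [show x + (n : ℤ) + n = x + 2 * n by ring, show y + (n : ℤ) + n = y + 2 * n by ring] at h1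
  exact h.trans _ _ _ h2 (h.trans _ _ _ h1 (h.symm _ _ h3))

theorem RAx.shift_iff {n : ℕ} {R : ℤ → ℤ → Prop} (h : RAx n R) (x y : ℤ) :
    R (x + n) (y + n) ↔ R x y := ⟨h.unshift x y, h.shift x y⟩

theorem RAx.zero_congr {n : ℕ} {R : ℤ → ℤ → Prop} (h : RAx n R) {x y : ℤ} (hxy : R x y)
    (hx : R x (x + n)) : R y (y + n) :=
  h.trans _ _ _ (h.symm _ _ hxy) (h.trans _ _ _ hx (h.shift _ _ hxy))

theorem RAx.per' {n : ℕ} {R : ℤ → ℤ → Prop} (h : RAx n R) (x : ℤ) (k : ℤ) :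
    R x (x + 2 * n * k) := by
  induction k using Int.induction_on with
  | zero => simpa using h.refl x
  | succ k ih =>
    have := h.trans _ _ _ ih (h.per _)
    rwa [show x + 2 * n * ((k : ℤ) + 1) = x + 2 * n * k + 2 * n by ring]
  | pred k ih =>
    refine h.trans _ _ _ ih (h.symm _ _ ?_)
    have := h.per (x + 2 * n * (-(k : ℤ) - 1))
    rwa [show x + 2 * n * (-(k : ℤ) - 1) + 2 * n = x + 2 * n * (-(k : ℤ)) by ring] at this

theorem OR_N (n : ℕ) (hn : 1 ≤ n) (R : ℤ → ℤ → Prop) (h : RAx n R) (x : ℤ) :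
    (∀ j, ¬ OR n R j x) ↔ R x (x + n) := by
  constructor
  · intro hj
    by_contra hx
    have hx' : ¬ R (x - n) x := by
      intro h'
      have := h.shift _ _ h'
      rw [sub_add_cancel] at this
      exact hx this
    obtain ⟨d, hd, hmin⟩ : ∃ d : ℕ, (R (x - n + 1 + d) x) ∧
        ∀ m < d, ¬ R (x - n + 1 + m) x := by
      classical
      have hex : ∃ d : ℕ, R (x - n + 1 + d) x := ⟨n - 1, by
        rw [show x - n + 1 + ((n - 1 : ℕ) : ℤ) = x by omega]; exact h.refl x⟩
      exact ⟨Nat.find hex, Nat.find_spec hex, fun m hm => Nat.find_min hex hm⟩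
    have hdn : d ≤ n - 1 := by
      by_contra hlt
      apply hmin (n - 1) (by omega)
      rw [show x - n + 1 + ((n - 1 : ℕ) : ℤ) = x by omega]; exact h.refl x
    set j := x - n + 1 + d with hjd
    apply hj j
    refine ⟨by omega, by omega, hd, fun h' => hx (h.zero_congr hd h'), fun z hz hzj hR => ?_⟩
    have hRzx := h.trans _ _ _ hR hd
    rcases lt_trichotomy z (x - n) with h' | h' | h'
    · have h1 := h.shift _ _ hRzx
      have h2 : R (x - n) (z + n) := by
        apply h.unshift
        rw [sub_add_cancel]
        exact h.trans _ _ _ (h.symm _ _ hRzx) (by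
          have := h.per z
          rwa [show z + 2 * (n : ℤ) = z + n + n by ring] at this)
      have := h.nc z (x - n) j (z + n) h' (by omega) (by omega) (by omega) hR h2
      exact hx' (h.trans _ _ _ (h.symm _ _ this) hRzx)
    · rw [h'] at hRzx
      exact hx' hRzx
    · apply hmin (z - (x - n + 1)).toNat (by omega)
      rw [show x - n + 1 + ((z - (x - n + 1)).toNat : ℤ) = z by omega]
      exact hRzx
  · intro hx j hj
    exact hj.2.2.2.1 (h.zero_congr (h.symm _ _ hj.2.2.1) hx)

theorem OR_ax (n : ℕ) (hn : 1 ≤ n) (R : ℤ → ℤ → Prop) (h : RAx n R) : OAx n (OR n R) where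
  rng j x hj := ⟨hj.1, hj.2.1⟩
  uniq i j x hi hj := by
    obtain ⟨i1, i2, i3, i4, i5⟩ := hi
    obtain ⟨j1, j2, j3, j4, j5⟩ := hj
    have hij := h.trans _ _ _ i3 (h.symm _ _ j3)
    rcases lt_trichotomy i j with h' | h' | h'
    · exact absurd hij (j5 i (by omega) h')
    · exact h'
    · exact absurd (h.symm _ _ hij) (i5 j (by omega) h')
  shift j x := by
    unfold OR
    rw [h.shift_iff, h.shift_iff]
    constructor
    · rintro ⟨h1, h2, h3, h4, h5⟩
      refine ⟨by omega, by omega, h3, h4, fun y hy hy' hR => ?_⟩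
      exact h5 (y + n) (by omega) (by omega) (h.shift _ _ hR)
    · rintro ⟨h1, h2, h3, h4, h5⟩
      refine ⟨by omega, by omega, h3, h4, fun y hy hy' hR => ?_⟩
      refine h5 (y - n) (by omega) (by omega) (h.unshift _ _ ?_)
      rwa [sub_add_cancel]
  nc j x i z hj hi hji hix := by
    obtain ⟨i1, i2, i3, i4, i5⟩ := hi
    obtain ⟨j1, j2, j3, j4, j5⟩ := hj
    by_contra hlt
    rcases eq_or_ne i x with rfl | hne
    · exact i5 j (by omega) hji j3
    · exact i5 j (by omega) hji
        (h.nc j i x z hji (by omega) (by omega) (by omega) j3 i3)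
  zero x hx i z hi hix := by
    rw [OR_N n hn R h] at hx
    obtain ⟨i1, i2, i3, i4, i5⟩ := hi
    by_contra hlt
    have hi0 : ¬ R i x := fun h' => i4 (h.zero_congr (h.symm _ _ h') hx)
    rcases eq_or_ne x z with rfl | hne
    · exact hi0 i3
    rcases eq_or_ne i x with rfl | hne'
    · exact hi0 (h.refl _)
    · exact hi0 (h.nc i x z (x + n) (by omega) (by omega) (by omega) (by omega) i3 hx)

theorem R_eq_Rel (n : ℕ) (hn : 1 ≤ n) (R : ℤ → ℤ → Prop) (h : RAx n R) (x y : ℤ) :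
    R x y ↔ Rel n (OR n R) x y := by
  constructor
  · intro hxy
    unfold Rel
    rw [OR_N n hn R h, OR_N n hn R h]
    by_cases hx : R x (x + n)
    · exact Or.inl ⟨hx, h.zero_congr hxy hx⟩
    right
    have key : ∀ i j x y, OR n R i x → OR n R j y → R x y → x - n < y → y < x + n → i = j := by
      have key1 : ∀ i j x y, OR n R i x → OR n R j y → R x y → x - n < y → y < x + n →
          ¬ i < j := by
        intro i j x y hi hj hxy h1 h2 hij
        obtain ⟨i1, i2, i3, i4, i5⟩ := hi
        obtain ⟨j1, j2, j3, j4, j5⟩ := hj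
        have hR : R i j := h.trans _ _ _ i3 (h.trans _ _ _ hxy (h.symm _ _ j3))
        have e1 : i ≤ j - n := by
          by_contra hlt
          exact j5 i (by omega) hij hR
        have e2 : i ≠ j - n := by
          intro e
          apply i4
          rwa [show i + n = j by omega]
        apply i5 (j - 2 * n) (by omega) (by omega)
        have := h.per (j - 2 * n)
        rw [sub_add_cancel] at this
        exact h.trans _ _ _ this (h.symm _ _ hR)
      intro i j x y hi hj hxy h1 h2
      have a1 := key1 i j x y hi hj hxy h1 h2
      have a2 := key1 j i y x hj hi (h.symm _ _ hxy) (by omega) (by omega)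
      omega
    obtain ⟨y', k, hy', hk1, hk2⟩ : ∃ y' k : ℤ, y = y' + 2 * n * k ∧ x - n ≤ y' ∧ y' < x + n := by
      have e1 := Int.emod_add_mul_ediv (y - (x - n)) (2 * n)
      have e2 := Int.emod_nonneg (y - (x - n)) (b := 2 * (n : ℤ)) (by omega)
      have e3 := Int.emod_lt_of_pos (y - (x - n)) (b := 2 * (n : ℤ)) (by omega)
      refine ⟨(y - (x - n)) % (2 * n) + (x - n), (y - (x - n)) / (2 * n), ?_, ?_, ?_⟩
      · linarith
      · linarith
      · linarith
    have hyy : R y' y := hy' ▸ h.per' y' k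
    have hxy' : R x y' := h.trans _ _ _ hxy (h.symm _ _ hyy)
    have hne : x - n ≠ y' := by
      rintro rfl
      apply hx
      have := h.symm _ _ (h.shift _ _ hxy')
      rw [sub_add_cancel] at this
      exact this
    have hxN : ¬ ∀ j, ¬ OR n R j x := fun h' => hx ((OR_N n hn R h x).1 h')
    have hyN : ¬ ∀ j, ¬ OR n R j y := fun h' => hx (h.zero_congr (h.symm _ _ hxy) ((OR_N n hn R h y).1 h'))
    have hyN' : ¬ ∀ j, ¬ OR n R j y' := fun h' => hx (h.zero_congr (h.symm _ _ hxy') ((OR_N n hn R h y').1 h'))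
    push Not at hxN hyN hyN'
    obtain ⟨i, hi⟩ := hxN
    obtain ⟨j, hj⟩ := hyN'
    have hij := key i j x y' hi hj hxy' (by omega) (by omega)
    have ax := OR_ax n hn R h
    have hshift : ∀ m : ℤ, OR n R (j + n * m) (y' + n * m) := by
      intro m
      induction m using Int.induction_on with
      | zero => simpa using hj
      | succ k ih =>
        rw [show j + n * ((k : ℤ) + 1) = j + n * k + n by ring,
          show y' + n * ((k : ℤ) + 1) = y' + n * k + n by ring]
        exact (ax.shift _ _).2 ih
      | pred k ih =>
        apply (ax.shift _ _).1
        rw [show j + n * (-(k : ℤ) - 1) + n = j + n * (-k) by ring,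
          show y' + n * (-(k : ℤ) - 1) + n = y' + n * (-k) by ring]
        exact ih
    refine ⟨i, j + n * (2 * k), hi, ?_, ?_⟩
    · have := hshift (2 * k)
      rwa [show y' + n * (2 * k) = y by rw [hy']; ring] at this
    · rw [hij]; exact ⟨k, by ring⟩
  · rintro (⟨hx, hy⟩ | ⟨i, j, hi, hj, k, hk⟩)
    · rw [OR_N n hn R h] at hx hy
      exact h.zero _ _ hx hy
    · have := h.per' i k
      rw [show i + 2 * n * k = j by omega] at this
      exact h.trans _ _ _ (h.symm _ _ hi.2.2.1) (h.trans _ _ _ this hj.2.2.1)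

theorem OAx.shiftk {n : ℕ} {O : ℤ → ℤ → Prop} (ax : OAx n O) {j x : ℤ} (h : O j x) (m : ℤ) :
    O (j + n * m) (x + n * m) := by
  induction m using Int.induction_on with
  | zero => simpa using h
  | succ k ih =>
    rw [show j + n * ((k : ℤ) + 1) = j + n * k + n by ring,
      show x + n * ((k : ℤ) + 1) = x + n * k + n by ring]
    exact (ax.shift _ _).2 ih
  | pred k ih =>
    apply (ax.shift _ _).1
    rw [show j + n * (-(k : ℤ) - 1) + n = j + n * (-k) by ring,
      show x + n * (-(k : ℤ) - 1) + n = x + n * (-k) by ring]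
    exact ih

/-- trichotomy for related points at distance less than `2n` -/
theorem Rel_cases (n : ℕ) (hn : 1 ≤ n) (O : ℤ → ℤ → Prop) (ax : OAx n O) (x y : ℤ)
    (hxy : x < y) (hy : y < x + 2 * n) (h : Rel n O x y) :
    ((∀ j, ¬ O j x) ∧ (∀ j, ¬ O j y)) ∨ (∃ j, O j x ∧ O j y) ∨
      (∃ j, O j x ∧ O (j + 2 * n) y) := by
  rcases h with h | ⟨i, j, hi, hj, k, hk⟩
  · exact Or.inl h
  · right
    have h1 := ax.rng _ _ hi
    have h2 := ax.rng _ _ hj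
    have k1 : -1 < k := by
      by_contra hlt
      have : 2 * (n : ℤ) * k ≤ 2 * n * (-1) := mul_le_mul_of_nonneg_left (by omega) (by omega)
      omega
    have k2 : k < 2 := by
      by_contra hlt
      have : 2 * (n : ℤ) * 2 ≤ 2 * n * k := mul_le_mul_of_nonneg_left (by omega) (by omega)
      omega
    obtain rfl | rfl : k = 0 ∨ k = 1 := by omega
    · left; exact ⟨i, hi, by rwa [show i = j by omega]⟩
    · right; exact ⟨i, hi, by rwa [show i + 2 * n = j by omega]⟩

theorem OAx.shift2 {n : ℕ} {O : ℤ → ℤ → Prop} (ax : OAx n O) {j x : ℤ} (h : O j x) :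
    O (j + 2 * n) (x + 2 * n) := by
  have := ax.shiftk h 2
  rwa [show (n : ℤ) * 2 = 2 * n by ring] at this

theorem OAx.zshift {n : ℕ} {O : ℤ → ℤ → Prop} (ax : OAx n O) (x : ℤ) :
    (∀ j, ¬ O j (x + n)) ↔ ∀ j, ¬ O j x := by
  constructor
  · intro h j hj
    exact h _ ((ax.shift _ _).2 hj)
  · intro h j hj
    apply h (j - n)
    rw [← ax.shift, sub_add_cancel]
    exact hj

theorem Rel_zero (n : ℕ) (hn : 1 ≤ n) (O : ℤ → ℤ → Prop) (ax : OAx n O) (x : ℤ) :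
    Rel n O x (x + n) ↔ ∀ j, ¬ O j x := by
  constructor
  · rintro (h | ⟨i, j, hi, hj, k, hk⟩)
    · exact h.1
    · have := ax.uniq _ _ _ hj ((ax.shift _ _).2 hi)
      have : (n : ℤ) * (2 * k - 1) = 0 := by linarith
      rcases mul_eq_zero.1 this with h | h <;> omega
  · intro h
    exact Or.inl ⟨h, (ax.zshift x).2 h⟩

theorem Rel_ax (n : ℕ) (hn : 1 ≤ n) (O : ℤ → ℤ → Prop) (ax : OAx n O) : RAx n (Rel n O) where
  refl x := by
    by_cases hx : ∀ j, ¬ O j x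
    · exact Or.inl ⟨hx, hx⟩
    · push Not at hx
      obtain ⟨j, hj⟩ := hx
      exact Or.inr ⟨j, j, hj, hj, by simp⟩
  symm x y h := by
    rcases h with h | ⟨i, j, hi, hj, hk⟩
    · exact Or.inl h.symm
    · exact Or.inr ⟨j, i, hj, hi, by rw [← neg_sub]; exact hk.neg_right⟩
  trans x y z h1 h2 := by
    rcases h1 with h1 | ⟨i, j, hi, hj, hk⟩
    · rcases h2 with h2 | ⟨i', j', hi', hj', hk'⟩
      · exact Or.inl ⟨h1.1, h2.2⟩
      · exact absurd hi' (h1.2 _)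
    · rcases h2 with h2 | ⟨i', j', hi', hj', hk'⟩
      · exact absurd hj (h2.1 _)
      · have := ax.uniq _ _ _ hj hi'
        subst this
        exact Or.inr ⟨i, j', hi, hj', by have := dvd_add hk' hk; simpa using this⟩
  shift x y h := by
    rcases h with h | ⟨i, j, hi, hj, hk⟩
    · exact Or.inl ⟨(ax.zshift x).2 h.1, (ax.zshift y).2 h.2⟩
    · exact Or.inr ⟨i + n, j + n, (ax.shift _ _).2 hi, (ax.shift _ _).2 hj, by simpa using hk⟩
  per x := by
    by_cases hx : ∀ j, ¬ O j x
    · refine Or.inl ⟨hx, ?_⟩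
      rw [show x + 2 * (n : ℤ) = x + n + n by ring]
      exact (ax.zshift _).2 ((ax.zshift _).2 hx)
    · push Not at hx
      obtain ⟨j, hj⟩ := hx
      exact Or.inr ⟨j, j + 2 * n, hj, ax.shift2 hj, by simp⟩
  zero x y hx hy := by
    rw [Rel_zero n hn O ax] at hx hy
    exact Or.inl ⟨hx, hy⟩
  nc a b c d hab hbc hcd hda hac hbd := by
    have mk : ∀ i, O i a → O i b → Rel n O a b := fun i h1 h2 =>
      Or.inr ⟨i, i, h1, h2, by simp⟩
    rcases Rel_cases n hn O ax a c (by omega) (by omega) hac with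
      ⟨ha, hc⟩ | ⟨i, ha, hc⟩ | ⟨i, ha, hc⟩ <;>
    rcases Rel_cases n hn O ax b d (by omega) (by omega) hbd with
      ⟨hb, hd⟩ | ⟨j, hb, hd⟩ | ⟨j, hb, hd⟩
    · exact Or.inl ⟨ha, hb⟩
    · have := ax.zero c hc j d hd (by have := ax.rng _ _ hb; omega)
      omega
    · have h1 : a < j := by
        by_contra hlt
        have := ax.zero a ha j b hb (by omega)
        omega
      have := ax.rng _ _ hd
      omega
    · have := ax.zero b hb i c hc (by have := ax.rng _ _ ha; omega)
      omega
    · have ra := ax.rng _ _ ha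
      have rb := ax.rng _ _ hb
      rcases lt_trichotomy i j with h' | h' | h'
      · have := ax.nc i c j d hc hd h' (by omega)
        omega
      · exact mk i ha (h' ▸ hb)
      · have := ax.nc j b i c hb hc h' (by omega)
        omega
    · have ra := ax.rng _ _ ha
      have rb := ax.rng _ _ hb
      have rd := ax.rng _ _ hd
      rcases lt_trichotomy i j with h' | h' | h'
      · have := ax.nc i a j b ha hb h' (by omega)
        omega
      · exact mk i ha (h' ▸ hb)
      · have := ax.nc j b i c hb hc h' (by omega)
        omega
    · have rc := ax.rng _ _ hc
      have := ax.zero d hd _ _ (ax.shift2 ha) (by omega)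
      omega
    · have ra := ax.shift2 ha
      have rc := ax.rng _ _ hc
      have rb := ax.rng _ _ hb
      have rd := ax.rng _ _ hd
      have ra' := ax.rng _ _ ha
      have rbs := ax.shift2 hb
      rcases lt_trichotomy (i + 2 * n) j with h' | h' | h'
      · have := ax.nc _ c j d hc hd h' (by omega)
        omega
      · refine Or.inr ⟨i, j, ha, hb, by rw [← h']; simp⟩
      · have := ax.nc j d (i + 2 * n) _ hd ra h' (by omega)
        omega
    · have ra := ax.shift2 ha
      have rbs := ax.shift2 hb
      have rc := ax.rng _ _ hc
      have rd := ax.rng _ _ hd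
      rcases lt_trichotomy i j with h' | h' | h'
      · have := ax.nc _ _ _ _ ra rbs (by omega) (by omega)
        omega
      · exact mk i ha (h' ▸ hb)
      · have := ax.nc _ _ _ _ hd ra (by omega) (by omega)
        omega

theorem OR_Rel (n : ℕ) (hn : 1 ≤ n) (O : ℤ → ℤ → Prop) (ax : OAx n O)
    (self : ∀ j x, O j x → O j j) (j x : ℤ) : OR n (Rel n O) j x ↔ O j x := by
  constructor
  · rintro ⟨h1, h2, h3, h4, h5⟩
    rw [Rel_zero n hn O ax] at h4
    push Not at h4
    obtain ⟨i, hi⟩ := h4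
    have ri := ax.rng _ _ hi
    have hij : i = j := by
      by_contra hne
      exact h5 i (by omega) (by omega) (Or.inr ⟨i, i, self _ _ hi, hi, by simp⟩)
    subst hij
    rcases h3 with h3 | ⟨i', j', hi', hj', k, hk⟩
    · exact absurd hi (h3.1 _)
    · have := ax.uniq _ _ _ hi hi'
      subst this
      have rj := ax.rng _ _ hj'
      have k1 : -1 < k := by
        by_contra hlt
        have : 2 * (n : ℤ) * k ≤ 2 * n * (-1) := mul_le_mul_of_nonneg_left (by omega) (by omega)
        omega
      have k2 : k < 1 := by
        by_contra hlt
        have : 2 * (n : ℤ) * 1 ≤ 2 * n * k := mul_le_mul_of_nonneg_left (by omega) (by omega)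
        omega
      obtain rfl : k = 0 := by omega
      rwa [show i = j' by omega]
  · intro h
    have hs := self _ _ h
    have r := ax.rng _ _ h
    refine ⟨r.1, r.2, Or.inr ⟨j, j, hs, h, by simp⟩, ?_, ?_⟩
    · rw [Rel_zero n hn O ax]
      exact fun h' => h' _ hs
    · rintro y hy hyj (h' | ⟨i, j', hi, hj', k, hk⟩)
      · exact h'.2 _ hs
      · have := ax.uniq _ _ _ hs hj'
        subst this
        have ri := ax.rng _ _ hi
        have k1 : 0 < k := by
          by_contra hlt
          have : 2 * (n : ℤ) * k ≤ 2 * n * 0 := mul_le_mul_of_nonneg_left (by omega) (by omega)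
          omega
        have : 2 * (n : ℤ) * 1 ≤ 2 * n * k := mul_le_mul_of_nonneg_left (by omega) (by omega)
        omega
end TB

namespace TB
theorem cnt_eq (n : ℕ) (O : ℤ → ℤ → Prop) (j : ℤ) :
    open Classical in
    cnt n O j = ∑ d ∈ Finset.range n, if O j (j + d) then 1 else 0 := by
  classical
  rw [cnt, Finset.card_filter, Ico_sum]

theorem cnt_per (n : ℕ) (O : ℤ → ℤ → Prop) (h : OAx n O) (j : ℤ) :
    cnt n O (j + n) = cnt n O j := by
  rw [cnt_eq, cnt_eq]
  apply Finset.sum_congr rfl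
  intro d _
  have := h.shift j (j + d)
  rw [show j + d + (n : ℤ) = j + n + d by ring] at this
  by_cases hO : O j (j + d)
  · rw [if_pos hO, if_pos (this.2 hO)]
  · rw [if_neg hO, if_neg (fun h' => hO (this.1 h'))]

theorem per_int (n : ℕ) (f : ℤ → ℕ) (hf : ∀ x, f (x + n) = f x) (x : ℤ) (k : ℤ) :
    f (x + n * k) = f x := by
  induction k using Int.induction_on with
  | zero => simp
  | succ k ih => rw [← ih, ← hf (x + n * k)]; congr 1; ring
  | pred k ih => rw [← ih, ← hf (x + n * (-(k : ℤ) - 1))]; congr 1; ring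

/-- reduction modulo `2n` -/
def tf {n : ℕ} (hn : 1 ≤ n) (x : ℤ) : Fin (2 * n) :=
  ⟨(x % (2 * n)).toNat, by
    have e2 := Int.emod_nonneg x (b := 2 * (n : ℤ)) (by omega)
    have e3 := Int.emod_lt_of_pos x (b := 2 * (n : ℤ)) (by omega)
    omega⟩

theorem tf_val {n : ℕ} (hn : 1 ≤ n) (x : ℤ) : (((tf hn x : Fin (2 * n)) : ℕ) : ℤ) = x % (2 * n) := by
  have e2 := Int.emod_nonneg x (b := 2 * (n : ℤ)) (by omega)
  simp only [tf]
  omega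

theorem tf_coe {n : ℕ} (hn : 1 ≤ n) (a : Fin (2 * n)) : tf hn ((a : ℕ) : ℤ) = a := by
  apply Fin.ext
  have h := tf_val hn ((a : ℕ) : ℤ)
  have := a.isLt
  rw [Int.emod_eq_of_lt (by omega) (by omega)] at h
  exact_mod_cast h

theorem tf_add {n : ℕ} (hn : 1 ≤ n) (x k : ℤ) : tf hn (x + 2 * n * k) = tf hn x := by
  apply Fin.ext
  have h := tf_val hn (x + 2 * n * k)
  have h' := tf_val hn x
  rw [Int.add_mul_emod_self_left, ← h'] at h
  exact_mod_cast h

theorem tf_decomp {n : ℕ} (hn : 1 ≤ n) (x : ℤ) :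
    ∃ k : ℤ, x = ((tf hn x : Fin (2 * n)) : ℕ) + 2 * n * k :=
  ⟨x / (2 * n), by rw [tf_val]; exact (Int.emod_add_mul_ediv x (2 * n)).symm⟩

theorem tf_neg {n : ℕ} (hn : 1 ≤ n) (x : ℤ) : tf hn (x + n) = negB (tf hn x) := by
  apply Fin.ext
  have h := tf_val hn (x + n)
  have h' := tf_val hn x
  have : ((negB (tf hn x) : Fin (2 * n)) : ℕ) = ((tf hn x : Fin (2 * n)) + n) % (2 * n) := rfl
  zify
  rw [this, h]
  push_cast
  rw [h', Int.emod_add_emod]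

/-- relation on `ℤ` of a partition -/
def RPi {n : ℕ} (hn : 1 ≤ n) (π : Finpartition (Finset.univ : Finset (Fin (2 * n)))) (x y : ℤ) :
    Prop := π.part (tf hn x) = π.part (tf hn y)

theorem mem_NCB {n : ℕ} (π : Finpartition (Finset.univ : Finset (Fin (2 * n)))) :
    π ∈ NCB n ↔ IsNoncrossing π ∧ (∀ B ∈ π.parts, negBlock B ∈ π.parts) ∧
    (π.parts.filter (fun B => negBlock B = B)).card ≤ 1 := by
  simp [NCB, fil]

theorem part_neg {n : ℕ} {π : Finpartition (Finset.univ : Finset (Fin (2 * n)))}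
    (h : ∀ B ∈ π.parts, negBlock B ∈ π.parts) (a : Fin (2 * n)) :
    π.part (negB a) = negBlock (π.part a) := by
  apply π.part_eq_of_mem (h _ (π.part_mem.2 (Finset.mem_univ _)))
  exact Finset.mem_image_of_mem _ (π.mem_part (Finset.mem_univ _))

theorem RPi_zero {n : ℕ} (hn : 1 ≤ n) {π : Finpartition (Finset.univ : Finset (Fin (2 * n)))}
    (h : ∀ B ∈ π.parts, negBlock B ∈ π.parts) (x : ℤ) :
    RPi hn π x (x + n) ↔ negBlock (π.part (tf hn x)) = π.part (tf hn x) := by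
  unfold RPi
  rw [tf_neg, part_neg h]
  exact eq_comm

theorem RPi_ax {n : ℕ} (hn : 1 ≤ n) (π : Finpartition (Finset.univ : Finset (Fin (2 * n))))
    (hπ : π ∈ NCB n) : RAx n (RPi hn π) := by
  obtain ⟨hnc, hneg, hz⟩ := (mem_NCB π).1 hπ
  have per : ∀ x k, tf hn (x + 2 * n * k) = tf hn x := tf_add hn
  constructor
  · intro x; rfl
  · intro x y h; exact h.symm
  · intro x y z h1 h2; exact h1.trans h2
  · intro x y h
    unfold RPi at *
    rw [tf_neg, tf_neg, part_neg hneg, part_neg hneg, h]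
  · intro x
    unfold RPi
    have := per x 1
    rw [mul_one] at this
    rw [this]
  · have base : ∀ a b c d : Fin (2 * n), a < b → b < c → c < d → π.part a = π.part c →
        π.part b = π.part d → π.part a = π.part b := by
      intro a b c d h1 h2 h3 h4 h5
      refine hnc a b c d h1 h2 h3 _ (π.part_mem.2 (Finset.mem_univ _)) _
        (π.part_mem.2 (Finset.mem_univ _)) (π.mem_part (Finset.mem_univ _)) ?_
        (π.mem_part (Finset.mem_univ _)) ?_
      · rw [h4]; exact π.mem_part (Finset.mem_univ _)
      · rw [h5]; exact π.mem_part (Finset.mem_univ _)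
    have base' : ∀ a b c d : ℤ, 0 ≤ a → a < b → b < c → c < d → d < 2 * n → RPi hn π a c →
        RPi hn π b d → RPi hn π a b := by
      intro a b c d h0 h1 h2 h3 h4 h5 h6
      have e : ∀ z : ℤ, 0 ≤ z → z < 2 * n → (((tf hn z : Fin (2 * n)) : ℕ) : ℤ) = z := by
        intro z h1 h2
        rw [tf_val, Int.emod_eq_of_lt h1 h2]
      have ea := e a (by omega) (by omega)
      have eb := e b (by omega) (by omega)
      have ec := e c (by omega) (by omega)
      have ed := e d (by omega) (by omega)
      exact base _ _ _ _ (by rw [Fin.lt_def]; omega) (by rw [Fin.lt_def]; omega)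
        (by rw [Fin.lt_def]; omega) h5 h6
    have red : ∀ x, tf hn (x - 2 * n) = tf hn x := by
      intro x
      rw [← per x (-1)]; congr 1; ring
    have base2 : ∀ a b c d : ℤ, 0 ≤ a → a < 2 * n → a < b → b < c → c < d → d < a + 2 * n →
        RPi hn π a c → RPi hn π b d → RPi hn π a b := by
      intro a b c d h0 h0' h1 h2 h3 h4 h5 h6
      rcases lt_or_ge d (2 * n) with hd | hd
      · exact base' a b c d h0 h1 h2 h3 hd h5 h6
      rcases lt_or_ge c (2 * n) with hc | hc
      · have := base' (d - 2 * n) a b c (by omega) (by omega) h1 h2 hc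
          (by unfold RPi at *; rw [red]; exact h6.symm) h5
        unfold RPi at *
        rw [red] at this
        rw [h6, this]
      rcases lt_or_ge b (2 * n) with hb | hb
      · have := base' (c - 2 * n) (d - 2 * n) a b (by omega) (by omega) (by omega) h1 hb
          (by unfold RPi at *; rw [red]; exact h5.symm) (by unfold RPi at *; rw [red]; exact h6.symm)
        unfold RPi at *
        rw [red, red] at this
        rw [h6, h5, this]
      · have := base' (b - 2 * n) (c - 2 * n) (d - 2 * n) a (by omega) (by omega) (by omega)
          (by omega) h0'
          (by unfold RPi at *; rw [red, red]; exact h6) (by unfold RPi at *; rw [red]; exact h5.symm)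
        unfold RPi at *
        rw [red, red] at this
        rw [h5, this]
    intro a b c d h1 h2 h3 h4 h5 h6
    obtain ⟨k, hk⟩ := tf_decomp hn a
    have hlt := (tf hn a).isLt
    generalize ((tf hn a : Fin (2 * n)) : ℕ) = a' at hk hlt
    have e : ∀ x, tf hn (x - 2 * n * k) = tf hn x := by
      intro x
      rw [← per x (-k)]; congr 1; ring
    have := base2 (a - 2 * n * k) (b - 2 * n * k) (c - 2 * n * k) (d - 2 * n * k) (by omega)
      (by omega) (by omega) (by omega) (by omega) (by omega)
      (by unfold RPi at *; rw [e, e]; exact h5) (by unfold RPi at *; rw [e, e]; exact h6)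
    unfold RPi at *
    rw [e, e] at this
    exact this
  · intro x y hx hy
    rw [RPi_zero hn hneg] at hx hy
    rw [Finset.card_le_one] at hz
    exact hz _ (by simp [hx]) _ (by simp [hy])

theorem zeroBlockSize_eq {n : ℕ} (hn : 1 ≤ n)
    (π : Finpartition (Finset.univ : Finset (Fin (2 * n)))) (hπ : π ∈ NCB n) :
    open Classical in
    zeroBlockSize π = 2 * ((Finset.range n).filter (fun x : ℕ => RPi hn π x (x + n))).card := by
  classical
  obtain ⟨hnc, hneg, hz⟩ := (mem_NCB π).1 hπ
  have ax := RPi_ax hn π hπ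
  have h1 : zeroBlockSize π =
      (Finset.univ.filter (fun a : Fin (2 * n) => RPi hn π (a : ℕ) ((a : ℕ) + n))).card := by
    unfold zeroBlockSize
    rw [← Finset.card_biUnion (t := fun B => B)]
    · congr 1
      ext a
      simp only [Finset.mem_biUnion, Finset.mem_filter, Finset.mem_univ, true_and]
      rw [RPi_zero hn hneg, tf_coe]
      constructor
      · rintro ⟨B, ⟨hB, hBn⟩, ha⟩
        rw [π.part_eq_of_mem hB ha, hBn]
      · intro h
        exact ⟨_, ⟨π.part_mem.2 (Finset.mem_univ _), h⟩, π.mem_part (Finset.mem_univ _)⟩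
    · intro B hB C hC hne
      simp only [Finset.coe_filter, Set.mem_ofPred_eq] at hB hC
      exact π.disjoint hB.1 hC.1 hne
  rw [h1, Finset.card_filter, Finset.card_filter,
    Fin.sum_univ_eq_sum_range (fun a : ℕ => if RPi hn π (a : ℤ) ((a : ℤ) + n) then 1 else 0),
    two_mul, Finset.sum_range_add, two_mul]
  congr 1
  apply Finset.sum_congr rfl
  intro x _
  have := ax.shift_iff (x : ℤ) (x + n)
  rw [add_comm (x : ℤ) n] at this
  push_cast
  rw [add_comm (x : ℤ) n]
  simp only [this]

theorem exists_pi {n : ℕ} (hn : 1 ≤ n) (R : ℤ → ℤ → Prop) (ax : RAx n R) :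
    ∃ π ∈ NCB n, ∀ x y, RPi hn π x y ↔ R x y := by
  classical
  let st : Setoid (Fin (2 * n)) :=
    { r := fun a b => R (a : ℕ) (b : ℕ)
      iseqv := ⟨fun a => ax.refl _, fun h => ax.symm _ _ h, fun h1 h2 => ax.trans _ _ _ h1 h2⟩ }
  let π := Finpartition.ofSetoid st
  have hp : ∀ a b, π.part a = π.part b ↔ R ((a : Fin (2 * n)) : ℕ) ((b : Fin (2 * n)) : ℕ) := by
    intro a b
    rw [← π.mem_part_iff_part_eq_part (Finset.mem_univ _) (Finset.mem_univ _)]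
    refine Finpartition.mem_part_ofSetoid_iff_rel.trans ?_
    exact ⟨fun h => ax.symm _ _ h, fun h => ax.symm _ _ h⟩
  have hR : ∀ x y, RPi hn π x y ↔ R x y := by
    intro x y
    unfold RPi
    rw [hp]
    obtain ⟨k, hk⟩ := tf_decomp hn x
    obtain ⟨l, hl⟩ := tf_decomp hn y
    have h1 := ax.per' (((tf hn x : Fin (2 * n)) : ℕ) : ℤ) k
    have h2 := ax.per' (((tf hn y : Fin (2 * n)) : ℕ) : ℤ) l
    rw [← hk] at h1
    rw [← hl] at h2
    exact ⟨fun h => ax.trans _ _ _ (ax.symm _ _ h1) (ax.trans _ _ _ h h2),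
      fun h => ax.trans _ _ _ h1 (ax.trans _ _ _ h (ax.symm _ _ h2))⟩
  have hrep : ∀ B ∈ π.parts, ∃ a, π.part a = B := by
    intro B hB
    obtain ⟨a, ha⟩ := π.nonempty_of_mem_parts hB
    exact ⟨a, π.part_eq_of_mem hB ha⟩
  have hpn : ∀ a b, π.part (negB a) = π.part (negB b) ↔ π.part a = π.part b := by
    intro a b
    have h := ax.shift_iff ((a : ℕ) : ℤ) ((b : ℕ) : ℤ)
    rw [← hR, ← hR] at h
    unfold RPi at h
    rwa [tf_neg, tf_neg, tf_coe, tf_coe] at h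
  have hnn : ∀ a : Fin (2 * n), negB (negB a) = a := by
    intro a
    have h1 := tf_neg hn ((a : ℕ) : ℤ)
    have h2 := tf_neg hn (((a : ℕ) : ℤ) + n)
    rw [h1, tf_coe] at h2
    rw [← h2]
    have := tf_add hn ((a : ℕ) : ℤ) 1
    rw [tf_coe, mul_one, two_mul (n : ℤ), ← add_assoc] at this
    exact this
  have hneg : ∀ B ∈ π.parts, negBlock B ∈ π.parts := by
    intro B hB
    obtain ⟨a, rfl⟩ := hrep B hB
    have : negBlock (π.part a) = π.part (negB a) := by
      ext b
      rw [π.mem_part_iff_part_eq_part (Finset.mem_univ _) (Finset.mem_univ _)]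
      simp only [negBlock, Finset.mem_image]
      constructor
      · rintro ⟨c, hc, rfl⟩
        rw [π.mem_part_iff_part_eq_part (Finset.mem_univ _) (Finset.mem_univ _)] at hc
        exact (hpn _ _).2 hc
      · intro h
        refine ⟨negB b, ?_, hnn b⟩
        rw [π.mem_part_iff_part_eq_part (Finset.mem_univ _) (Finset.mem_univ _), ← hpn, hnn]
        exact h
    rw [this]
    exact π.part_mem.2 (Finset.mem_univ _)
  refine ⟨π, (mem_NCB π).2 ⟨?_, hneg, ?_⟩, hR⟩
  · intro a b c d hab hbc hcd B hB C hC ha hc hb hd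
    have e1 := π.part_eq_of_mem hB ha
    have e2 := π.part_eq_of_mem hB hc
    have e3 := π.part_eq_of_mem hC hb
    have e4 := π.part_eq_of_mem hC hd
    rw [← e1, ← e3, hp]
    rw [Fin.lt_def] at hab hbc hcd
    have := d.isLt
    exact ax.nc _ (b : ℕ) (c : ℕ) (d : ℕ) (by omega) (by omega) (by omega) (by omega)
      ((hp _ _).1 (e1.trans e2.symm)) ((hp _ _).1 (e3.trans e4.symm))
  · rw [Finset.card_le_one]
    intro B hB C hC
    simp only [Finset.mem_filter] at hB hC
    obtain ⟨a, rfl⟩ := hrep B hB.1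
    obtain ⟨b, rfl⟩ := hrep C hC.1
    have h1 := (RPi_zero hn hneg ((a : ℕ) : ℤ)).2 (by rw [tf_coe]; exact hB.2)
    have h2 := (RPi_zero hn hneg ((b : ℕ) : ℤ)).2 (by rw [tf_coe]; exact hC.2)
    rw [hR] at h1 h2
    exact (hp _ _).2 (ax.zero _ _ h1 h2)

theorem pi_ext {n : ℕ} (hn : 1 ≤ n) (π π' : Finpartition (Finset.univ : Finset (Fin (2 * n))))
    (h : ∀ x y, RPi hn π x y ↔ RPi hn π' x y) : π = π' := by
  have hp : ∀ a, π.part a = π'.part a := by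
    intro a
    ext b
    rw [π.mem_part_iff_part_eq_part (Finset.mem_univ _) (Finset.mem_univ _),
      π'.mem_part_iff_part_eq_part (Finset.mem_univ _) (Finset.mem_univ _)]
    have := h ((b : ℕ) : ℤ) ((a : ℕ) : ℤ)
    unfold RPi at this
    rwa [tf_coe, tf_coe] at this
  apply Finpartition.ext
  ext B
  constructor
  · intro hB
    obtain ⟨a, ha⟩ := π.nonempty_of_mem_parts hB
    rw [← π.part_eq_of_mem hB ha, hp]
    exact π'.part_mem.2 (Finset.mem_univ _)
  · intro hB
    obtain ⟨a, ha⟩ := π'.nonempty_of_mem_parts hB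
    rw [← π'.part_eq_of_mem hB ha, ← hp]
    exact π.part_mem.2 (Finset.mem_univ _)

theorem card_funs (n m : ℕ) (hn : 1 ≤ n) :
    (Finset.piAntidiag (Finset.univ : Finset (Fin n)) m).card = Nat.choose (n + m - 1) (n - 1) := by
  rw [← Finset.map_sym_eq_piAntidiag, Finset.card_map, Finset.sym_univ, Finset.card_univ,
    Sym.card_sym_eq_multichoose, Fintype.card_fin, Nat.multichoose_eq]
  rw [← Nat.choose_symm (by omega)]
  congr 1
  omega

/-- periodic extension -/
def pext {n : ℕ} (hn : 1 ≤ n) (f : Fin n → ℕ) (x : ℤ) : ℕ :=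
  f ⟨(x % n).toNat, by
    have e2 := Int.emod_nonneg x (b := (n : ℤ)) (by omega)
    have e3 := Int.emod_lt_of_pos x (b := (n : ℤ)) (by omega)
    omega⟩

theorem pext_coe {n : ℕ} (hn : 1 ≤ n) (f : Fin n → ℕ) (j : Fin n) :
    pext hn f ((j : ℕ) : ℤ) = f j := by
  unfold pext
  congr 1
  apply Fin.ext
  simp only
  rw [Int.emod_eq_of_lt (by omega) (by omega)]
  simp

theorem pext_per {n : ℕ} (hn : 1 ≤ n) (f : Fin n → ℕ) (x : ℤ) :
    pext hn f (x + n) = pext hn f x := by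
  unfold pext
  simp

/-- the zero-block size and the opener function -/
theorem sum_F {n : ℕ} (hn : 1 ≤ n) (π : Finpartition (Finset.univ : Finset (Fin (2 * n))))
    (hπ : π ∈ NCB n) :
    2 * (∑ j : Fin n, cnt n (OR n (RPi hn π)) ((j : ℕ) : ℤ)) + zeroBlockSize π = 2 * n := by
  classical
  have ax := RPi_ax hn π hπ
  have h1 := sum_cnt n _ (OR_ax n hn _ ax)
  simp only [OR_N n hn _ ax] at h1
  rw [zeroBlockSize_eq hn π hπ,
    Fin.sum_univ_eq_sum_range (fun a : ℕ => cnt n (OR n (RPi hn π)) (a : ℤ))]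
  rw [← mul_add, h1]
end TB

/-- The number of type `B_n` non-crossing partitions having a zero-block of cardinality
`2t` equals `binom(2n-t-1, n-1)`. -/
theorem typeB_count_zeroBlock (n t : ℕ) (hn : 1 ≤ n) (ht1 : 1 ≤ t) (htn : t ≤ n) :
    (fil (NCB n) (fun π => zeroBlockSize π = 2 * t)).card =
      Nat.choose (2 * n - t - 1) (n - 1) := by
  classical
  have hc := TB.card_funs n (n - t) hn
  rw [show n + (n - t) - 1 = 2 * n - t - 1 by omega] at hc
  rw [← hc]
  have hmem : ∀ π, π ∈ fil (NCB n) (fun π => zeroBlockSize π = 2 * t) ↔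
      π ∈ NCB n ∧ zeroBlockSize π = 2 * t := by
    intro π; simp [fil]
  apply Finset.card_bij (fun π _ => fun j : Fin n => TB.cnt n (TB.OR n (TB.RPi hn π)) ((j : ℕ) : ℤ))
  · intro π hπ
    rw [hmem] at hπ
    have := TB.sum_F hn π hπ.1
    simp only [Finset.mem_piAntidiag, Finset.mem_univ, implies_true, and_true]
    omega
  · intro π hπ π' hπ' h
    rw [hmem] at hπ hπ'
    have ax := TB.RPi_ax hn π hπ.1
    have ax' := TB.RPi_ax hn π' hπ'.1
    have oax := TB.OR_ax n hn _ ax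
    have oax' := TB.OR_ax n hn _ ax'
    have hcnt : ∀ x, TB.cnt n (TB.OR n (TB.RPi hn π)) x = TB.cnt n (TB.OR n (TB.RPi hn π')) x := by
      intro x
      have e1 := Int.emod_add_mul_ediv x n
      have e2 := Int.emod_nonneg x (b := (n : ℤ)) (by omega)
      have e3 := Int.emod_lt_of_pos x (b := (n : ℤ)) (by omega)
      rw [← e1, TB.per_int n _ (TB.cnt_per n _ oax), TB.per_int n _ (TB.cnt_per n _ oax')]
      have := congrFun h ⟨(x % n).toNat, by omega⟩
      simp only at this
      rwa [Int.toNat_of_nonneg e2] at this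
    obtain ⟨S, hS⟩ := TB.exists_S (TB.cnt n (TB.OR n (TB.RPi hn π)))
    have hO : TB.OR n (TB.RPi hn π) = TB.OR n (TB.RPi hn π') := by
      funext j x
      apply propext
      rw [← TB.OS_eq n _ oax S hS, ← TB.OS_eq n _ oax' S (by intro x; rw [← hcnt]; exact hS x)]
    apply TB.pi_ext hn
    intro x y
    rw [TB.R_eq_Rel n hn _ ax, TB.R_eq_Rel n hn _ ax', hO]
  · intro f hf
    simp only [Finset.mem_piAntidiag, Finset.mem_univ, implies_true, and_true] at hf
    obtain ⟨S, hS⟩ := TB.exists_S (TB.pext hn f)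
    have hper : ∀ x, S (x + n) = S x - t := by
      intro x
      rw [TB.S_diff S _ hS x n, ← Nat.cast_sum, TB.Ico_sum,
        TB.sum_shift n _ (TB.pext_per hn f),
        ← Fin.sum_univ_eq_sum_range (fun a : ℕ => TB.pext hn f (a : ℤ))]
      simp only [TB.pext_coe, hf]
      omega
    have oax := TB.OS_ax n S t (by omega) hper
    obtain ⟨π, hπ, hR⟩ := TB.exists_pi hn _ (TB.Rel_ax n hn _ oax)
    have hR' : TB.RPi hn π = TB.Rel n (TB.OS S) := by
      funext x y; exact propext (hR x y)
    have hO : TB.OR n (TB.RPi hn π) = TB.OS S := by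
      funext j x
      rw [hR']
      exact propext (TB.OR_Rel n hn _ oax (TB.OS_self S) j x)
    have hF : (fun j : Fin n => TB.cnt n (TB.OR n (TB.RPi hn π)) ((j : ℕ) : ℤ)) = f := by
      funext j
      rw [hO, TB.OS_cnt n S _ t (by omega) hS hper, TB.pext_coe]
    refine ⟨π, ?_, hF⟩
    rw [hmem]
    refine ⟨hπ, ?_⟩
    have := TB.sum_F hn π hπ
    have h2 : ∑ j : Fin n, TB.cnt n (TB.OR n (TB.RPi hn π)) ((j : ℕ) : ℤ) = n - t := by
      rw [← hf]
      exact Finset.sum_congr rfl (fun j _ => congrFun hF j)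
    omega
end
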